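/- arXiv:math/9903132 — 2 statements merged into one kernel-verified Lean document; each statement's English description precedes it below -/
import Mathlib

section
/- Let s : Â → A be the ℂ-linear map sending each basis element â_{I,J} of Â (J ⊆ {ℓ+2,…,n}) to a_{I,J} ∈ A, and for 1 ≤ q ≤ n−ℓ set B^q = (ker π) ∩ A^q. Then for each such q, the ℂ-linear map Φ^q : (Â^{q−1})^{⊕ℓ} → A defined by Φ^q(η₁,…,η_ℓ) = Σ_{i=1}^{ℓ} a_{i,ℓ+1} ∧ s(η_i) is injective with image exactly B^q, and for every λ ∈ ℂ^N and every (η₁,…,η_ℓ) one has ω_λ ∧ Φ^q(η₁,…,η_ℓ) = Φ^{q+1}(−ω̂_λ∧η₁, …, −ω̂_λ∧η_ℓ). (Thus the kernel subcomplex of π is isomorphic to the direct sum of ℓ copies of the complex (Â, ω̂_λ∧·) shifted in degree by one, with the sign of the differential reversed.) -/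
namespace OSDisc

/-- Hyperplane index set: pairs (i,j) with 1 ≤ i < j, ℓ+1 ≤ j ≤ n. -/
def Idx (ℓ n : ℕ) : Type :=
  {p : ℕ × ℕ // 1 ≤ p.1 ∧ p.1 < p.2 ∧ ℓ + 1 ≤ p.2 ∧ p.2 ≤ n}

/-- The exterior algebra E over ℂ on the vector space with basis e_{i,j}. -/
abbrev E (ℓ n : ℕ) : Type := ExteriorAlgebra ℂ (Idx ℓ n →₀ ℂ)

/-- The generators e_{i,j} of E (junk value 0 for invalid indices). -/
noncomputable def gen (ℓ n : ℕ) (i j : ℕ) : E ℓ n :=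
  if h : 1 ≤ i ∧ i < j ∧ ℓ + 1 ≤ j ∧ j ≤ n then
    ExteriorAlgebra.ι ℂ (Finsupp.single (⟨(i, j), h⟩ : Idx ℓ n) (1 : ℂ))
  else 0

/-- Relations generating the Orlik-Solomon ideal. -/
def rel (ℓ n : ℕ) : E ℓ n → E ℓ n → Prop := fun x y =>
  y = 0 ∧
    ((∃ i j k, 1 ≤ i ∧ i < j ∧ j < k ∧ k ≤ n ∧ ℓ + 1 ≤ j ∧
        x = gen ℓ n i j * gen ℓ n i k - gen ℓ n i j * gen ℓ n j k
            + gen ℓ n i k * gen ℓ n j k) ∨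
      (∃ i j k, 1 ≤ i ∧ i < j ∧ j ≤ ℓ ∧ ℓ < k ∧ k ≤ n ∧
        x = gen ℓ n i k * gen ℓ n j k))

/-- The Orlik-Solomon algebra A = E/I of the discriminantal arrangement A_{n,ℓ}. -/
abbrev A (ℓ n : ℕ) : Type := RingQuot (rel ℓ n)

/-- The quotient map E → A. -/
noncomputable def projA (ℓ n : ℕ) : E ℓ n →ₐ[ℂ] A ℓ n := RingQuot.mkAlgHom ℂ (rel ℓ n)

/-- The generators a_{i,j} of A. -/
noncomputable def a (ℓ n : ℕ) (i j : ℕ) : A ℓ n := projA ℓ n (gen ℓ n i j)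

/-- The degree-q component E^q of the exterior algebra. -/
noncomputable def Edeg (ℓ n : ℕ) (q : ℕ) : Submodule ℂ (E ℓ n) :=
  (LinearMap.range (ExteriorAlgebra.ι ℂ : (Idx ℓ n →₀ ℂ) →ₗ[ℂ] E ℓ n)) ^ q

/-- A^q: the image in A of the degree-q component of E. -/
noncomputable def Adeg (ℓ n : ℕ) (q : ℕ) : Submodule ℂ (A ℓ n) :=
  (Edeg ℓ n q).map (projA ℓ n).toLinearMap

/-- The element a_{I,J}: the product of a_{f j, j} over j ∈ J in increasing order. -/
noncomputable def aIJ (ℓ n : ℕ) (J : Finset ℕ) (f : ℕ → ℕ) : A ℓ n :=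
  ((J.sort (· ≤ ·)).map fun j => a ℓ n (f j) j).prod

/-- ω_λ ∈ A¹. -/
noncomputable def omega (ℓ n : ℕ) (lam : ℕ × ℕ → ℂ) : A ℓ n :=
  ∑ j ∈ Finset.Icc (ℓ + 1) n, ∑ i ∈ Finset.Ico 1 j, lam (i, j) • a ℓ n i j

/-- ω_{k,λ} = Σ_{i=1}^{k−1} λ_{i,k}·a_{i,k}. -/
noncomputable def omegaK (ℓ n : ℕ) (lam : ℕ × ℕ → ℂ) (k : ℕ) : A ℓ n :=
  ∑ i ∈ Finset.Ico 1 k, lam (i, k) • a ℓ n i k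

/-- The index set of the hyperplanes, as a predicate. -/
def Valid (ℓ n i j : ℕ) : Prop := 1 ≤ i ∧ i < j ∧ ℓ + 1 ≤ j ∧ j ≤ n

section Generators

variable {ℓ n : ℕ}

/-- The basis vector of the degree-one part of `E` indexed by a valid pair. -/
noncomputable def basisVec {i j : ℕ} (h : Valid ℓ n i j) : Idx ℓ n →₀ ℂ :=
  Finsupp.single ⟨(i, j), h⟩ 1

theorem gen_of_valid {i j : ℕ} (h : Valid ℓ n i j) :
    gen ℓ n i j = ExteriorAlgebra.ι ℂ (basisVec h) :=
  dif_pos h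

theorem a_of_not_valid {i j : ℕ} (h : ¬ Valid ℓ n i j) : a ℓ n i j = 0 := by
  have : gen ℓ n i j = 0 := dif_neg h
  rw [a, this, map_zero]

theorem a_anticomm (i j k l : ℕ) :
    a ℓ n i j * a ℓ n k l = -(a ℓ n k l * a ℓ n i j) := by
  by_cases h : Valid ℓ n i j
  · by_cases h' : Valid ℓ n k l
    · rw [eq_neg_iff_add_eq_zero, a, a, gen_of_valid h, gen_of_valid h', ← map_mul (projA ℓ n),
        ← map_mul (projA ℓ n), ← map_add (projA ℓ n), ExteriorAlgebra.ι_add_mul_swap, map_zero]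
    · simp [a_of_not_valid h']
  · simp [a_of_not_valid h]

theorem a_mul_self (i j : ℕ) : a ℓ n i j * a ℓ n i j = 0 := by
  by_cases h : Valid ℓ n i j
  · rw [a, gen_of_valid h, ← map_mul (projA ℓ n), ExteriorAlgebra.ι_sq_zero, map_zero]
  · simp [a_of_not_valid h]

theorem a_arnold {i j k : ℕ} (hi : 1 ≤ i) (hij : i < j) (hjk : j < k) (hk : k ≤ n)
    (hj : ℓ + 1 ≤ j) :
    a ℓ n i j * a ℓ n i k - a ℓ n i j * a ℓ n j k + a ℓ n i k * a ℓ n j k = 0 := by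
  have h : rel ℓ n _ 0 := ⟨rfl, Or.inl ⟨i, j, k, hi, hij, hjk, hk, hj, rfl⟩⟩
  simpa [a, projA] using RingQuot.mkAlgHom_rel ℂ h

theorem a_mul_eq_zero {i j k : ℕ} (hi : 1 ≤ i) (hij : i < j) (hj : j ≤ ℓ) (hk : ℓ < k)
    (hkn : k ≤ n) : a ℓ n i k * a ℓ n j k = 0 := by
  have h : rel ℓ n _ 0 := ⟨rfl, Or.inr ⟨i, j, k, hi, hij, hj, hk, hkn, rfl⟩⟩
  simpa [a, projA] using RingQuot.mkAlgHom_rel ℂ h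

theorem map_mem_of_basisVec {B : Type*} [AddCommGroup B] [Module ℂ B] {P : Submodule ℂ B}
    (f : (Idx ℓ n →₀ ℂ) →ₗ[ℂ] B)
    (h : ∀ i j (hv : Valid ℓ n i j), f (basisVec hv) ∈ P)
    (v : Idx ℓ n →₀ ℂ) : f v ∈ P := by
  induction v using Finsupp.induction_linear with
  | zero => simp
  | add v w hv hw => rw [map_add]; exact P.add_mem hv hw
  | single p c =>
    have hc : Finsupp.single p c = c • basisVec (i := p.1.1) (j := p.1.2) p.2 := by
      exact ((Finsupp.smul_single c _ 1).trans (congrArg _ (mul_one c))).symm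
    rw [hc, map_smul]
    exact P.smul_mem _ (h _ _ _)

/-- An induction principle: `A` is generated as an algebra by the `a i j`. -/
theorem A_induction {C : A ℓ n → Prop} (hC : ∀ r : ℂ, C (algebraMap ℂ _ r))
    (ha : ∀ i j, Valid ℓ n i j → C (a ℓ n i j))
    (hmul : ∀ x y, C x → C y → C (x * y)) (hadd : ∀ x y, C x → C y → C (x + y)) (x : A ℓ n) :
    C x := by
  obtain ⟨e, rfl⟩ := RingQuot.mkAlgHom_surjective ℂ (rel ℓ n) x
  have h0 : C 0 := by simpa using hC 0
  let P : Submodule ℂ (A ℓ n) :=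
    { carrier := {x | C x}
      add_mem' := fun {x y} hx hy => hadd x y hx hy
      zero_mem' := h0
      smul_mem' := fun r x hx => by
        rw [Algebra.smul_def]; exact hmul _ _ (hC r) hx }
  induction e using ExteriorAlgebra.induction with
  | algebraMap r => simpa using hC r
  | ι v =>
    refine map_mem_of_basisVec (P := P)
      ((RingQuot.mkAlgHom ℂ (rel ℓ n)).toLinearMap ∘ₗ ExteriorAlgebra.ι ℂ) (fun i j hv => ?_) v
    have := ha i j hv
    rw [a, gen_of_valid hv] at this
    exact this
  | mul x y hx hy => rw [map_mul]; exact hmul _ _ hx hy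
  | add x y hx hy => rw [map_add]; exact hadd _ _ hx hy

/-- The universal property of `A`. -/
theorem exists_lift {B : Type*} [Ring B] [Algebra ℂ B] (g : ℕ → ℕ → B)
    (hanti : ∀ i j k l, Valid ℓ n i j → Valid ℓ n k l → g i j * g k l = -(g k l * g i j))
    (harnold : ∀ i j k, 1 ≤ i → i < j → j < k → k ≤ n → ℓ + 1 ≤ j →
      g i j * g i k - g i j * g j k + g i k * g j k = 0)
    (hzero : ∀ i j k, 1 ≤ i → i < j → j ≤ ℓ → ℓ < k → k ≤ n → g i k * g j k = 0) :
    ∃ φ : A ℓ n →ₐ[ℂ] B, ∀ i j, Valid ℓ n i j → φ (a ℓ n i j) = g i j := by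
  let f : (Idx ℓ n →₀ ℂ) →ₗ[ℂ] B := Finsupp.linearCombination ℂ fun p => g p.1.1 p.1.2
  have hf : ∀ i j (hv : Valid ℓ n i j),
      f (basisVec hv) = g i j := by
    intro i j hv
    refine (Finsupp.linearCombination_single ..).trans (one_smul ..)
  have hf1 : ∀ i j, Valid ℓ n i j → ∀ v, f v * g i j = -(g i j * f v) := by
    intro i j hv v
    have := map_mem_of_basisVec
      (P := LinearMap.ker (LinearMap.mulRight ℂ (g i j) + LinearMap.mulLeft ℂ (g i j))) f
      (fun k l hkl => by
        rw [hf]; simp [hanti i j k l hv hkl]) v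
    simpa [eq_neg_iff_add_eq_zero] using this
  have hf2 : ∀ v w, f v * f w = -(f w * f v) := by
    intro v w
    have := map_mem_of_basisVec
      (P := LinearMap.ker (LinearMap.mulRight ℂ (f w) + LinearMap.mulLeft ℂ (f w))) f
      (fun k l hkl => by
        rw [hf]; simp [hf1 k l hkl w]) v
    simpa [eq_neg_iff_add_eq_zero] using this
  have hf3 : ∀ v, f v * f v = 0 := by
    intro v
    have h := hf2 v v
    rw [eq_neg_iff_add_eq_zero, ← two_smul ℂ, smul_eq_zero] at h
    exact h.resolve_left two_ne_zero
  let F : E ℓ n →ₐ[ℂ] B := ExteriorAlgebra.lift ℂ ⟨f, hf3⟩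
  have hF : ∀ i j, Valid ℓ n i j → F (gen ℓ n i j) = g i j := by
    intro i j hv
    rw [gen_of_valid hv, ← hf i j hv]
    exact ExteriorAlgebra.lift_ι_apply ..
  refine ⟨RingQuot.liftAlgHom ℂ ⟨F, ?_⟩, fun i j hv => ?_⟩
  · rintro x y ⟨rfl, ⟨i, j, k, hi, hij, hjk, hk, hj, rfl⟩ | ⟨i, j, k, hi, hij, hj, hk, hkn, rfl⟩⟩
    · rw [map_zero, map_add, map_sub, map_mul, map_mul, map_mul, hF i j, hF i k, hF j k]
      · exact harnold i j k hi hij hjk hk hj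
      all_goals unfold Valid; omega
    · rw [map_zero, map_mul, hF i k, hF j k]
      · exact hzero i j k hi hij hj hk hkn
      all_goals unfold Valid; omega
  · rw [← hF i j hv]
    exact RingQuot.liftAlgHom_mkAlgHom_apply ..

theorem algHom_eq_of_a {B : Type*} [Ring B] [Algebra ℂ B] {φ ψ : A ℓ n →ₐ[ℂ] B}
    (h : ∀ i j, Valid ℓ n i j → φ (a ℓ n i j) = ψ (a ℓ n i j)) (x : A ℓ n) : φ x = ψ x := by
  induction x using A_induction with
  | hC r => simp
  | ha i j hv => exact h i j hv
  | hmul x y hx hy => simp [hx, hy]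
  | hadd x y hx hy => simp [hx, hy]

/-- The symmetrized generators, `c i j = c j i`, which vanish on the diagonal. -/
noncomputable def symA (ℓ n i j : ℕ) : A ℓ n := a ℓ n i j + a ℓ n j i

theorem symA_comm (i j : ℕ) : symA ℓ n i j = symA ℓ n j i := add_comm _ _

theorem symA_of_lt {i j : ℕ} (h : i < j) : symA ℓ n i j = a ℓ n i j := by
  rw [symA, a_of_not_valid (i := j), add_zero]
  unfold Valid; omega

theorem symA_self (i : ℕ) : symA ℓ n i i = 0 := by
  rw [symA, a_of_not_valid, add_zero]
  unfold Valid; omega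

theorem symA_anticomm_a (i j k l : ℕ) :
    symA ℓ n i j * a ℓ n k l = -(a ℓ n k l * symA ℓ n i j) := by
  simp only [symA, add_mul, mul_add, a_anticomm i j k l, a_anticomm j i k l]; abel

theorem symA_anticomm (i j k l : ℕ) :
    symA ℓ n i j * symA ℓ n k l = -(symA ℓ n k l * symA ℓ n i j) := by
  rw [symA, add_mul, mul_add, neg_add, neg_eq_iff_eq_neg.mpr (symA_anticomm_a k l i j),
    neg_eq_iff_eq_neg.mpr (symA_anticomm_a k l j i)]

theorem symA_mul_self (i j : ℕ) : symA ℓ n i j * symA ℓ n i j = 0 := by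
  rcases lt_trichotomy i j with h | rfl | h
  · rw [symA_of_lt h, a_mul_self]
  · rw [symA_self, zero_mul]
  · rw [symA_comm, symA_of_lt h, a_mul_self]

theorem symA_arnold_of_lt {i j k : ℕ} (hij : i < j) (hjk : j < k) :
    symA ℓ n i j * symA ℓ n j k = symA ℓ n i j * symA ℓ n i k + symA ℓ n i k * symA ℓ n j k := by
  rw [symA_of_lt hij, symA_of_lt hjk, symA_of_lt (hij.trans hjk)]
  by_cases hi : 1 ≤ i
  · by_cases hk : ℓ + 1 ≤ k ∧ k ≤ n
    · by_cases hj : ℓ + 1 ≤ j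
      · have := a_arnold (ℓ := ℓ) hi hij hjk hk.2 hj
        rw [sub_add, sub_eq_zero] at this
        rw [this]; abel
      · rw [a_mul_eq_zero hi hij (by omega) hk.1 hk.2, a_of_not_valid (i := i) (j := j)]
        · simp
        · unfold Valid; omega
    · rw [a_of_not_valid (j := k), a_of_not_valid (i := i) (j := k)]
      · simp
      all_goals unfold Valid; omega
  · rw [a_of_not_valid (j := k) (i := i), a_of_not_valid (i := i) (j := j)]
    · simp
    all_goals unfold Valid; omega

/-- The Arnold relation in symmetric form, valid for all indices. -/
theorem symA_arnold (i j k : ℕ) :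
    symA ℓ n i j * symA ℓ n j k = symA ℓ n i j * symA ℓ n i k + symA ℓ n i k * symA ℓ n j k := by
  rcases eq_or_ne i j with rfl | h1
  · simp [symA_self, symA_mul_self]
  rcases eq_or_ne j k with rfl | h2
  · simp [symA_self, symA_mul_self]
  rcases eq_or_ne i k with rfl | h3
  · simp [symA_self, symA_comm j i, symA_mul_self]
  have hij := symA_comm (ℓ := ℓ) (n := n) i j
  have hjk := symA_comm (ℓ := ℓ) (n := n) j k
  have hik := symA_comm (ℓ := ℓ) (n := n) i k
  have ha := symA_anticomm (ℓ := ℓ) (n := n) i j j k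
  have hb := symA_anticomm (ℓ := ℓ) (n := n) i j i k
  have hc := symA_anticomm (ℓ := ℓ) (n := n) i k j k
  have key : ∀ x y z : ℕ, x < y → y < z → symA ℓ n x y * symA ℓ n y z
      = symA ℓ n x y * symA ℓ n x z + symA ℓ n x z * symA ℓ n y z :=
    fun x y z => symA_arnold_of_lt
  rcases lt_or_gt_of_ne h1 with h1 | h1 <;> rcases lt_or_gt_of_ne h2 with h2 | h2 <;>
    rcases lt_or_gt_of_ne h3 with h3 | h3 <;> grind

end Generators

section FiberModule

/-! The free module `R ⊕ ⨁ₖ bₖ R` on which the algebra obtained from `R` by adding one further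
point acts; `dAct r` and `bAct i` are the actions of degree-one elements `r ∈ R` and of `bᵢ`. -/

variable {R : Type*} [Ring R] [Algebra ℂ R]

/-- Left multiplication by a degree-one element `r` on `R ⊕ ⨁ₖ bₖ R`. -/
noncomputable def dAct (r : R) : Module.End ℂ (R × (ℕ → R)) where
  toFun m := (r * m.1, fun k => -(r * m.2 k))
  map_add' x y := by ext <;> simp [mul_add, add_comm]
  map_smul' t x := by ext <;> simp

/-- Left multiplication by `bᵢ` on `R ⊕ ⨁ₖ bₖ R`, where `bᵢ bⱼ = cᵢⱼ (bⱼ - bᵢ)`. -/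
noncomputable def bAct (c : ℕ → ℕ → R) (n i : ℕ) : Module.End ℂ (R × (ℕ → R)) where
  toFun m := (0, fun k =>
    (if k = i then m.1 + ∑ l ∈ Finset.Icc 1 n, c i l * m.2 l else 0) - c i k * m.2 k)
  map_add' x y := by
    ext k
    · simp
    · by_cases h : k = i
      · simp [h, mul_add, Finset.sum_add_distrib]; abel
      · simp [h, mul_add]; abel
  map_smul' t x := by
    ext k
    · simp
    · by_cases h : k = i
      · simp [h, smul_sub, Finset.smul_sum]
      · simp [h]

theorem dAct_anticomm {r r' : R} (h : r * r' = -(r' * r)) :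
    dAct r * dAct r' = -(dAct r' * dAct r) := by
  refine LinearMap.ext fun m => Prod.ext ?_ (funext fun k => ?_) <;>
    simp [dAct, ← mul_assoc, h]

variable {c : ℕ → ℕ → R} {n : ℕ}

theorem dAct_bAct_anticomm {r : R} (h : ∀ i j, c i j * r = -(r * c i j)) (i : ℕ) :
    dAct r * bAct c n i = -(bAct c n i * dAct r) := by
  refine LinearMap.ext fun m => ?_
  refine Prod.ext (by simp [dAct, bAct]) (funext fun k => ?_)
  by_cases hk : k = i
  · subst hk
    simp [dAct, bAct, mul_sub, mul_add, ← mul_assoc, h, Finset.mul_sum]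
  · simp [dAct, bAct, hk, ← mul_assoc, h]

theorem bAct_mul_bAct (hself : ∀ i, c i i = 0)
    (harn : ∀ i j k, c i j * c j k = c i j * c i k + c i k * c j k) {i j : ℕ}
    (hj : j ∈ Finset.Icc 1 n) :
    bAct c n i * bAct c n j = dAct (c i j) * (bAct c n j - bAct c n i) := by
  refine LinearMap.ext fun m => ?_
  refine Prod.ext (by simp [dAct, bAct]) (funext fun k => ?_)
  obtain ⟨x, y⟩ := m
  have hsum : ∑ l ∈ Finset.Icc 1 n, c i l * ((if l = j then
        x + ∑ l ∈ Finset.Icc 1 n, c j l * y l else 0) - c j l * y l)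
      = c i j * (x + ∑ l ∈ Finset.Icc 1 n, c i l * y l) := by
    simp only [mul_sub, mul_ite, mul_zero]
    rw [Finset.sum_sub_distrib, Finset.sum_ite_eq', if_pos hj, mul_add, mul_add, add_sub_assoc,
      Finset.mul_sum, Finset.mul_sum, ← Finset.sum_sub_distrib]
    congr 1
    refine Finset.sum_congr rfl fun l _ => ?_
    rw [← mul_assoc, ← mul_assoc, ← mul_assoc, harn, add_mul]; abel
  have hx : c i k * (c j k * y k) = c i j * (c j k * y k) - c i j * (c i k * y k) := by
    rw [← mul_assoc, ← mul_assoc, ← mul_assoc, harn i j k, add_mul]; abel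
  simp only [Module.End.mul_apply, bAct, dAct, LinearMap.coe_mk, AddHom.coe_mk,
    LinearMap.sub_apply, Prod.snd_sub, Pi.sub_apply, hsum, zero_add]
  simp only [mul_sub, hx]
  by_cases h1 : k = i <;> by_cases h2 : k = j
  · subst h1; subst h2; simp [hself]
  · subst h1; simp [h2, hself]
  · subst h2; simp [h1, hself]
  · simp [h1, h2]; abel

end FiberModule

section AddPoint

variable {ℓ n : ℕ}

theorem exists_incl (ℓ n : ℕ) :
    ∃ φ : A ℓ n →ₐ[ℂ] A ℓ (n + 1), ∀ i j, Valid ℓ n i j → φ (a ℓ n i j) = a ℓ (n + 1) i j :=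
  exists_lift _ (fun _ _ _ _ _ _ => a_anticomm ..)
    (fun _ _ _ hi hij hjk hk hj => a_arnold hi hij hjk (by omega) hj)
    (fun _ _ _ hi hij hj hk hkn => a_mul_eq_zero hi hij hj hk (by omega))

/-- The natural map from the algebra on `n` points to the algebra on `n + 1` points. -/
noncomputable def incl (ℓ n : ℕ) : A ℓ n →ₐ[ℂ] A ℓ (n + 1) := (exists_incl ℓ n).choose

theorem incl_a {i j : ℕ} (h : j ≤ n) : incl ℓ n (a ℓ n i j) = a ℓ (n + 1) i j := by
  by_cases hv : Valid ℓ n i j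
  · exact (exists_incl ℓ n).choose_spec i j hv
  · rw [a_of_not_valid hv, a_of_not_valid, map_zero]
    unfold Valid at *; omega

theorem incl_symA {i j : ℕ} (hi : i ≤ n) (hj : j ≤ n) :
    incl ℓ n (symA ℓ n i j) = symA ℓ (n + 1) i j := by
  rw [symA, map_add, incl_a hi, incl_a hj, symA]

theorem a_last_mul_a_last {i j : ℕ} (hi : i ≤ n) (hj : j ≤ n) :
    a ℓ (n + 1) i (n + 1) * a ℓ (n + 1) j (n + 1)
      = (a ℓ (n + 1) i (n + 1) - a ℓ (n + 1) j (n + 1)) * incl ℓ n (symA ℓ n i j) := by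
  have h := symA_arnold (ℓ := ℓ) (n := n + 1) i j (n + 1)
  rw [symA_of_lt (i := j) (by omega), symA_of_lt (i := i) (j := n + 1) (by omega),
    symA_anticomm_a, symA_anticomm_a] at h
  rw [incl_symA hi hj, sub_mul, ← sub_eq_iff_eq_add'.mpr h]
  abel

theorem exists_action (hℓ : ℓ ≤ n) :
    ∃ ψ : A ℓ (n + 1) →ₐ[ℂ] Module.End ℂ (A ℓ n × (ℕ → A ℓ n)),
      (∀ i j, Valid ℓ n i j → ψ (a ℓ (n + 1) i j) = dAct (a ℓ n i j)) ∧
      ∀ i ∈ Finset.Icc 1 n, ψ (a ℓ (n + 1) i (n + 1)) = bAct (symA ℓ n) n i := by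
  have hbb : ∀ i j, j ∈ Finset.Icc 1 n → bAct (symA ℓ n) n i * bAct (symA ℓ n) n j
      = dAct (symA ℓ n i j) * (bAct (symA ℓ n) n j - bAct (symA ℓ n) n i) := fun i j hj =>
    bAct_mul_bAct symA_self symA_arnold hj
  have hdb : ∀ i j k, dAct (a ℓ n i j) * bAct (symA ℓ n) n k
      = -(bAct (symA ℓ n) n k * dAct (a ℓ n i j)) := fun i j k =>
    dAct_bAct_anticomm (fun p r => symA_anticomm_a p r i j) k
  have hdd : ∀ i j k l, dAct (a ℓ n i j) * dAct (a ℓ n k l)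
      = -(dAct (a ℓ n k l) * dAct (a ℓ n i j)) := fun i j k l =>
    dAct_anticomm (a_anticomm i j k l)
  have hd0 : dAct (0 : A ℓ n) = 0 := LinearMap.ext fun m => by simp [dAct]; rfl
  obtain ⟨ψ, hψ⟩ := exists_lift (ℓ := ℓ) (n := n + 1)
    (fun i j => if j = n + 1 then bAct (symA ℓ n) n i else dAct (a ℓ n i j))
    (by
      intro i j k l h1 h2
      unfold Valid at h1 h2
      by_cases hj : j = n + 1 <;> by_cases hl : l = n + 1
      · simp only [hj, hl, if_true]
        rw [hbb i k (by simp; omega), hbb k i (by simp; omega), symA_comm k i]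
        rw [mul_sub, mul_sub, neg_sub]
      · simp only [hj, hl, if_true, if_false]
        rw [hdb, neg_neg]
      · simp only [hj, hl, if_true, if_false]
        rw [hdb]
      · simp only [hj, hl, if_false]
        rw [hdd])
    (by
      intro i j k hi hij hjk hk hj
      by_cases hkn : k = n + 1
      · simp only [hkn, if_true, if_neg (show j ≠ n + 1 by omega)]
        rw [hbb i j (by simp; omega), symA_of_lt hij, mul_sub]
        abel
      · simp only [hkn, if_neg (show j ≠ n + 1 by omega), if_false]
        have h := a_arnold (ℓ := ℓ) (n := n) hi hij hjk (by omega) hj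
        refine LinearMap.ext fun m => Prod.ext ?_ (funext fun k => ?_)
        · simpa [dAct, sub_mul, add_mul, mul_assoc] using congrArg (· * m.1) h
        · simpa [dAct, sub_mul, add_mul, mul_assoc] using congrArg (· * m.2 k) h)
    (by
      intro i j k hi hij hj hk hkn
      by_cases hkn : k = n + 1
      · simp only [hkn, if_true]
        rw [hbb i j (by simp; omega), symA_of_lt hij, a_of_not_valid, hd0, zero_mul]
        unfold Valid; omega
      · simp only [hkn, if_false]
        have h := a_mul_eq_zero (ℓ := ℓ) (n := n) hi hij hj hk (by omega)
        refine LinearMap.ext fun m => Prod.ext ?_ (funext fun k => ?_) <;>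
          simp [dAct, ← mul_assoc, h])
  refine ⟨ψ, fun i j hv => ?_, fun i hi => ?_⟩
  · unfold Valid at hv
    rw [hψ i j (by unfold Valid; omega), if_neg (by omega)]
  · rw [Finset.mem_Icc] at hi
    rw [hψ i (n + 1) (by unfold Valid; omega), if_pos rfl]

/-- The map `(x₀, x) ↦ x₀ + ∑ₖ bₖ xₖ`, where `bₖ = a k (n + 1)`. -/
noncomputable def assemble (ℓ n : ℕ) : A ℓ n × (ℕ → A ℓ n) →ₗ[ℂ] A ℓ (n + 1) where
  toFun m := incl ℓ n m.1 + ∑ k ∈ Finset.Icc 1 n, a ℓ (n + 1) k (n + 1) * incl ℓ n (m.2 k)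
  map_add' x y := by simp [mul_add, Finset.sum_add_distrib]; abel
  map_smul' t x := by simp [Finset.smul_sum]

theorem assemble_apply (m : A ℓ n × (ℕ → A ℓ n)) : assemble ℓ n m
    = incl ℓ n m.1 + ∑ k ∈ Finset.Icc 1 n, a ℓ (n + 1) k (n + 1) * incl ℓ n (m.2 k) := rfl

theorem assemble_dAct {i j : ℕ} (hj : j ≤ n) (m : A ℓ n × (ℕ → A ℓ n)) :
    assemble ℓ n (dAct (a ℓ n i j) m) = a ℓ (n + 1) i j * assemble ℓ n m := by
  simp only [assemble_apply, dAct, LinearMap.coe_mk, AddHom.coe_mk, map_mul, map_neg, incl_a hj,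
    mul_add, Finset.mul_sum, mul_neg]
  congr 1
  refine Finset.sum_congr rfl fun k _ => ?_
  rw [← mul_assoc, ← mul_assoc, a_anticomm i j, neg_mul]

theorem assemble_bAct {i : ℕ} (hi : i ∈ Finset.Icc 1 n) (m : A ℓ n × (ℕ → A ℓ n)) :
    assemble ℓ n (bAct (symA ℓ n) n i m) = a ℓ (n + 1) i (n + 1) * assemble ℓ n m := by
  have hi' := (Finset.mem_Icc.mp hi).2
  simp only [assemble_apply, bAct, LinearMap.coe_mk, AddHom.coe_mk, map_zero, zero_add, map_sub,
    mul_sub, apply_ite (incl ℓ n), mul_ite, mul_zero]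
  rw [Finset.sum_sub_distrib, Finset.sum_ite_eq', if_pos hi]
  simp only [map_add, map_sum, map_mul, mul_add, Finset.mul_sum, add_sub_assoc]
  rw [← Finset.sum_sub_distrib]
  congr 1
  refine Finset.sum_congr rfl fun k hk => ?_
  rw [← mul_assoc (a ..) (a ..), a_last_mul_a_last hi' (Finset.mem_Icc.mp hk).2, sub_mul, sub_mul,
    mul_assoc, mul_assoc]

theorem a_cases_last {i j : ℕ} (h : Valid ℓ (n + 1) i j) :
    Valid ℓ n i j ∨ (i ∈ Finset.Icc 1 n ∧ j = n + 1) := by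
  unfold Valid at *
  rw [Finset.mem_Icc]
  omega

/-- Coordinates of elements of `A ℓ (n + 1)` over `A ℓ n`, as a section of `assemble`
compatible with left multiplication by generators. -/
theorem exists_coords (hℓ : ℓ ≤ n) :
    ∃ T : A ℓ (n + 1) →ₗ[ℂ] A ℓ n × (ℕ → A ℓ n),
      (∀ x, assemble ℓ n (T x) = x) ∧
      (∀ i j x, Valid ℓ n i j → T (a ℓ (n + 1) i j * x) = dAct (a ℓ n i j) (T x)) ∧
      ∀ i ∈ Finset.Icc 1 n, ∀ x,
        T (a ℓ (n + 1) i (n + 1) * x) = bAct (symA ℓ n) n i (T x) := by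
  obtain ⟨ψ, hψ1, hψ2⟩ := exists_action hℓ
  have key : ∀ x m, assemble ℓ n (ψ x m) = x * assemble ℓ n m := by
    intro x
    induction x using A_induction with
    | hC r => intro m; rw [AlgHom.commutes]; simp [Algebra.algebraMap_eq_smul_one]
    | ha i j hv =>
      intro m
      rcases a_cases_last hv with hv | ⟨hi, rfl⟩
      · rw [hψ1 i j hv, assemble_dAct hv.2.2.2]
      · rw [hψ2 i hi, assemble_bAct hi]
    | hmul x y hx hy => intro m; rw [map_mul, Module.End.mul_apply, hx, hy, mul_assoc]
    | hadd x y hx hy => intro m; rw [map_add, LinearMap.add_apply, map_add, hx, hy, add_mul]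
  refine ⟨LinearMap.applyₗ (1, 0) ∘ₗ ψ.toLinearMap, fun x => ?_, fun i j x hv => ?_,
    fun i hi x => ?_⟩
  · have := key x (1, 0)
    simpa [assemble_apply] using this
  · simp [hψ1 i j hv]
  · simp [hψ2 i hi]

end AddPoint

section StandardMonomials

variable {ℓ n : ℕ}

theorem aIJ_congr {J : Finset ℕ} {f g : ℕ → ℕ} (h : ∀ j ∈ J, f j = g j) :
    aIJ ℓ n J f = aIJ ℓ n J g := by
  unfold aIJ
  congr 1
  exact List.map_congr_left fun j hj => by rw [h j ((Finset.mem_sort _).mp hj)]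

theorem map_aIJ {ℓ' n' : ℕ} (φ : A ℓ n →ₐ[ℂ] A ℓ' n') {J : Finset ℕ} {f : ℕ → ℕ}
    (h : ∀ j ∈ J, φ (a ℓ n (f j) j) = a ℓ' n' (f j) j) : φ (aIJ ℓ n J f) = aIJ ℓ' n' J f := by
  unfold aIJ
  rw [map_list_prod, List.map_map]
  congr 1
  exact List.map_congr_left fun j hj => h j ((Finset.mem_sort _).mp hj)

theorem aIJ_insert_min {J : Finset ℕ} {m : ℕ} (f : ℕ → ℕ) (h : ∀ j ∈ J, m < j) :
    aIJ ℓ n (insert m J) f = a ℓ n (f m) m * aIJ ℓ n J f := by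
  unfold aIJ
  rw [Finset.sort_insert _ (fun j hj => (h j hj).le) (fun hm => (h m hm).false),
    List.map_cons, List.prod_cons]

theorem aIJ_insert_max {J : Finset ℕ} {m : ℕ} (f : ℕ → ℕ) (h : ∀ j ∈ J, j < m) :
    aIJ ℓ n (insert m J) f = aIJ ℓ n J f * a ℓ n (f m) m := by
  have hsort : (insert m J).sort (· ≤ ·) = J.sort (· ≤ ·) ++ [m] := by
    have hnd : (J.sort (· ≤ ·) ++ [m]).Nodup :=
      List.Nodup.append (Finset.sort_nodup _ _) (List.nodup_singleton m)
        (by simpa using fun hm => (h m hm).false)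
    have hfs : (J.sort (· ≤ ·) ++ [m]).toFinset = insert m J := by ext; simp
    rw [← hfs, List.toFinset_sort _ hnd, List.pairwise_append]
    exact ⟨Finset.pairwise_sort _ _, List.pairwise_singleton _ _,
      fun j hj k hk => by
        rw [List.mem_singleton.mp hk]
        exact (h j ((Finset.mem_sort _).mp hj)).le⟩
  simp [aIJ, hsort]

theorem a_mul_aIJ (i j : ℕ) (J : Finset ℕ) (f : ℕ → ℕ) :
    ∃ ε : ℂ, a ℓ n i j * aIJ ℓ n J f = ε • (aIJ ℓ n J f * a ℓ n i j) ∧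
      aIJ ℓ n J f * a ℓ n i j = ε • (a ℓ n i j * aIJ ℓ n J f) := by
  unfold aIJ
  induction J.sort (· ≤ ·) with
  | nil => exact ⟨1, by simp⟩
  | cons p L ih =>
    obtain ⟨ε, h1, h2⟩ := ih
    refine ⟨-ε, ?_, ?_⟩
    · rw [List.map_cons, List.prod_cons, ← mul_assoc, a_anticomm i j, neg_mul, mul_assoc, h1]
      simp [mul_assoc]
    · rw [List.map_cons, List.prod_cons, mul_assoc, h2, ← mul_assoc, a_anticomm i j]
      simp [mul_assoc]

/-- The span of the standard monomials of degree `q`. -/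
noncomputable def stdSpan (ℓ n q : ℕ) : Submodule ℂ (A ℓ n) :=
  Submodule.span ℂ {x | ∃ (J : Finset ℕ) (f : ℕ → ℕ), J ⊆ Finset.Icc (ℓ + 1) n ∧ J.card = q ∧
    (∀ j ∈ J, 1 ≤ f j ∧ f j < j) ∧ (∀ j, j ∉ J → f j = 0) ∧ x = aIJ ℓ n J f}

theorem aIJ_mem_stdSpan {J : Finset ℕ} {f : ℕ → ℕ} (hJ : J ⊆ Finset.Icc (ℓ + 1) n)
    (hf : ∀ j ∈ J, 1 ≤ f j ∧ f j < j) : aIJ ℓ n J f ∈ stdSpan ℓ n J.card := by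
  refine Submodule.subset_span ⟨J, fun j => if j ∈ J then f j else 0, hJ, rfl, fun j hj => ?_,
    fun j hj => if_neg hj, aIJ_congr fun j hj => (if_pos hj).symm⟩
  simpa [hj] using hf j hj

theorem incl_mem_stdSpan {q : ℕ} {x : A ℓ n} (hx : x ∈ stdSpan ℓ n q) :
    incl ℓ n x ∈ stdSpan ℓ (n + 1) q := by
  refine Submodule.span_induction (p := fun x _ => incl ℓ n x ∈ stdSpan ℓ (n + 1) q)
    ?_ (by simp) (fun x y _ _ hx hy => by rw [map_add]; exact add_mem hx hy)
    (fun r x _ hx => by rw [map_smul]; exact Submodule.smul_mem _ _ hx) hx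
  rintro x ⟨J, f, hJ, rfl, hf, -, rfl⟩
  rw [map_aIJ _ fun j hj => incl_a (Finset.mem_Icc.mp (hJ hj)).2]
  exact aIJ_mem_stdSpan (hJ.trans (Finset.Icc_subset_Icc_right (by omega))) hf

theorem a_last_mul_incl_mem_stdSpan (hℓ : ℓ ≤ n) {q i : ℕ} {x : A ℓ n} (hi : i ∈ Finset.Icc 1 n)
    (hx : x ∈ stdSpan ℓ n q) :
    a ℓ (n + 1) i (n + 1) * incl ℓ n x ∈ stdSpan ℓ (n + 1) (q + 1) := by
  refine Submodule.span_induction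
    (p := fun x _ => a ℓ (n + 1) i (n + 1) * incl ℓ n x ∈ stdSpan ℓ (n + 1) (q + 1))
    ?_ (by simp) (fun x y _ _ hx hy => by rw [map_add, mul_add]; exact add_mem hx hy)
    (fun r x _ hx => by rw [map_smul, mul_smul_comm]; exact Submodule.smul_mem _ _ hx) hx
  rintro x ⟨J, f, hJ, rfl, hf, -, rfl⟩
  have hlt : ∀ j ∈ J, j < n + 1 := fun j hj => Nat.lt_succ_of_le (Finset.mem_Icc.mp (hJ hj)).2
  have hn : n + 1 ∉ J := fun h => (hlt _ h).false
  rw [map_aIJ _ fun j hj => incl_a (Finset.mem_Icc.mp (hJ hj)).2]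
  obtain ⟨ε, h, -⟩ := a_mul_aIJ (ℓ := ℓ) (n := n + 1) i (n + 1) J f
  have hmem : ∀ j ∈ J, Function.update f (n + 1) i j = f j := fun j hj =>
    Function.update_of_ne (hlt j hj).ne _ _
  have hins := aIJ_insert_max (ℓ := ℓ) (n := n + 1) (Function.update f (n + 1) i) hlt
  rw [Function.update_self, aIJ_congr hmem] at hins
  rw [h, ← hins, ← Finset.card_insert_of_notMem hn]
  refine Submodule.smul_mem _ _ (aIJ_mem_stdSpan ?_ ?_)
  · intro j hj
    rw [Finset.mem_insert] at hj
    rcases hj with rfl | hj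
    · rw [Finset.mem_Icc]; omega
    · have := Finset.mem_Icc.mp (hJ hj)
      rw [Finset.mem_Icc]; omega
  · intro j hj
    rw [Finset.mem_insert] at hj
    rcases hj with rfl | hj
    · rw [Function.update_self]
      have := Finset.mem_Icc.mp hi
      omega
    · rw [hmem j hj]; exact hf j hj

/-- Every standard monomial on `n + 1` points is either a standard monomial on `n` points, or the
product of one with some `bᵢ`. -/
theorem stdSpan_succ_induction {q : ℕ} {P : Submodule ℂ (A ℓ (n + 1))}
    (h0 : ∀ x ∈ stdSpan ℓ n q, incl ℓ n x ∈ P)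
    (h1 : ∀ p, q = p + 1 → ∀ i ∈ Finset.Icc 1 n, ∀ x ∈ stdSpan ℓ n p,
      a ℓ (n + 1) i (n + 1) * incl ℓ n x ∈ P) : stdSpan ℓ (n + 1) q ≤ P := by
  refine Submodule.span_le.mpr ?_
  rintro _ ⟨J, f, hJ, rfl, hf, -, rfl⟩
  by_cases hn : n + 1 ∈ J
  · obtain ⟨K, hK, rfl⟩ : ∃ K, n + 1 ∉ K ∧ J = insert (n + 1) K :=
      ⟨J.erase (n + 1), Finset.notMem_erase _ _, (Finset.insert_erase hn).symm⟩
    have hK' : K ⊆ Finset.Icc (ℓ + 1) n := by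
      intro j hj
      have := Finset.mem_Icc.mp (hJ (Finset.mem_insert_of_mem hj))
      have : j ≠ n + 1 := fun h => hK (h ▸ hj)
      rw [Finset.mem_Icc]; omega
    have hfn := hf _ (Finset.mem_insert_self _ _)
    rw [aIJ_insert_max _ fun j hj => Nat.lt_succ_of_le (Finset.mem_Icc.mp (hK' hj)).2]
    obtain ⟨ε, -, h⟩ := a_mul_aIJ (ℓ := ℓ) (n := n + 1) (f (n + 1)) (n + 1) K f
    rw [h, ← map_aIJ (incl ℓ n) fun j hj => incl_a (Finset.mem_Icc.mp (hK' hj)).2]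
    exact P.smul_mem _ (h1 _ (Finset.card_insert_of_notMem hK) _ (Finset.mem_Icc.mpr (by omega)) _
      (aIJ_mem_stdSpan hK' fun j hj => hf j (Finset.mem_insert_of_mem hj)))
  · have hJ' : J ⊆ Finset.Icc (ℓ + 1) n := by
      intro j hj
      have := Finset.mem_Icc.mp (hJ hj)
      have : j ≠ n + 1 := fun h => hn (h ▸ hj)
      rw [Finset.mem_Icc]; omega
    rw [← map_aIJ (incl ℓ n) fun j hj => incl_a (Finset.mem_Icc.mp (hJ' hj)).2]
    exact h0 _ (aIJ_mem_stdSpan hJ' hf)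

theorem a_mul_mem_stdSpan (hℓ : ℓ ≤ n) (i j q : ℕ) (x : A ℓ n) (hx : x ∈ stdSpan ℓ n q) :
    a ℓ n i j * x ∈ stdSpan ℓ n (q + 1) := by
  induction n, hℓ using Nat.le_induction generalizing i j q with
  | base =>
    rw [a_of_not_valid, zero_mul]
    · exact zero_mem _
    · unfold Valid; omega
  | succ n hn ih =>
    by_cases hv : Valid ℓ (n + 1) i j
    swap
    · rw [a_of_not_valid hv, zero_mul]; exact zero_mem _
    refine stdSpan_succ_induction
      (P := (stdSpan ℓ (n + 1) (q + 1)).comap (LinearMap.mulLeft ℂ (a ℓ (n + 1) i j)))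
      (fun y hy => ?_) (fun p hp k hk y hy => ?_) hx
    · rw [Submodule.mem_comap, LinearMap.mulLeft_apply]
      rcases a_cases_last hv with hv | ⟨hi, rfl⟩
      · rw [← incl_a hv.2.2.2, ← map_mul]
        exact incl_mem_stdSpan (ih i j q y hy)
      · exact a_last_mul_incl_mem_stdSpan hn hi hy
    · subst hp
      rw [Submodule.mem_comap, LinearMap.mulLeft_apply, ← mul_assoc]
      rcases a_cases_last hv with hv | ⟨hi, rfl⟩
      · rw [a_anticomm, ← incl_a hv.2.2.2, neg_mul, mul_assoc, ← map_mul]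
        exact neg_mem (a_last_mul_incl_mem_stdSpan hn hk (ih i j p y hy))
      · rw [a_last_mul_a_last (Finset.mem_Icc.mp hi).2 (Finset.mem_Icc.mp hk).2, mul_assoc,
          ← map_mul, sub_mul]
        have : symA ℓ n i k * y ∈ stdSpan ℓ n (p + 1) := by
          rw [symA, add_mul]
          exact add_mem (ih i k p y hy) (ih k i p y hy)
        exact sub_mem (a_last_mul_incl_mem_stdSpan hn hi this)
          (a_last_mul_incl_mem_stdSpan hn hk this)

theorem one_mem_stdSpan : (1 : A ℓ n) ∈ stdSpan ℓ n 0 := by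
  simpa [aIJ] using aIJ_mem_stdSpan (ℓ := ℓ) (n := n) (J := ∅) (f := 0) (by simp) (by simp)

theorem Adeg_succ (q : ℕ) : Adeg ℓ n (q + 1) = Adeg ℓ n 1 * Adeg ℓ n q := by
  unfold Adeg Edeg
  rw [pow_succ', pow_one]
  exact Submodule.map_mul _ _ (projA ℓ n)

theorem one_mem_Adeg : (1 : A ℓ n) ∈ Adeg ℓ n 0 :=
  ⟨1, by simp [Edeg], map_one (projA ℓ n)⟩

theorem a_mem_Adeg (i j : ℕ) : a ℓ n i j ∈ Adeg ℓ n 1 := by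
  by_cases hv : Valid ℓ n i j
  · rw [a, gen_of_valid hv]
    exact ⟨_, by simp [Edeg], rfl⟩
  · rw [a_of_not_valid hv]; exact zero_mem _

theorem a_mul_mem_Adeg (i j : ℕ) {q : ℕ} {x : A ℓ n} (hx : x ∈ Adeg ℓ n q) :
    a ℓ n i j * x ∈ Adeg ℓ n (q + 1) := by
  rw [Adeg_succ]
  exact Submodule.mul_mem_mul (a_mem_Adeg i j) hx

theorem Adeg_le_stdSpan (hℓ : ℓ ≤ n) (q : ℕ) : Adeg ℓ n q ≤ stdSpan ℓ n q := by
  induction q with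
  | zero =>
    rintro _ ⟨x, hx, rfl⟩
    unfold Edeg at hx
    rw [pow_zero] at hx
    obtain ⟨r, rfl⟩ := Submodule.mem_one.mp hx
    rw [AlgHom.toLinearMap_apply, AlgHom.commutes, Algebra.algebraMap_eq_smul_one]
    exact Submodule.smul_mem _ _ one_mem_stdSpan
  | succ q ih =>
    rw [Adeg_succ, Submodule.mul_le]
    rintro _ ⟨_, hv, rfl⟩ y hy
    unfold Edeg at hv
    rw [pow_one] at hv
    obtain ⟨v, rfl⟩ := hv
    refine map_mem_of_basisVec (P := (stdSpan ℓ n (q + 1)).comap (LinearMap.mulRight ℂ y))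
      ((projA ℓ n).toLinearMap ∘ₗ ExteriorAlgebra.ι ℂ) (fun i j hv => ?_) v
    have := a_mul_mem_stdSpan hℓ i j q y (ih hy)
    rw [a, gen_of_valid hv] at this
    exact this

theorem aIJ_mem_Adeg (J : Finset ℕ) (f : ℕ → ℕ) : aIJ ℓ n J f ∈ Adeg ℓ n J.card := by
  unfold aIJ
  rw [← Finset.length_sort (· ≤ ·)]
  induction J.sort (· ≤ ·) with
  | nil => exact one_mem_Adeg
  | cons p L ih =>
    rw [List.map_cons, List.prod_cons, List.length_cons]
    exact a_mul_mem_Adeg _ _ ih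

theorem iSup_stdSpan (hℓ : ℓ ≤ n) : ⨆ q, stdSpan ℓ n q = ⊤ := by
  have key : ∀ x : A ℓ n, ∀ y ∈ ⨆ q, stdSpan ℓ n q, x * y ∈ ⨆ q, stdSpan ℓ n q := by
    intro x
    induction x using A_induction with
    | hC r =>
      intro y hy
      rw [← Algebra.smul_def]
      exact Submodule.smul_mem _ _ hy
    | ha i j hv =>
      intro y hy
      refine Submodule.iSup_induction (motive := fun y => a ℓ n i j * y ∈ ⨆ q, stdSpan ℓ n q) _ hy
        (fun q x hx => ?_) (by simp) (fun x y hx hy => ?_)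
      · exact Submodule.mem_iSup_of_mem (q + 1) (a_mul_mem_stdSpan hℓ i j q x hx)
      · rw [mul_add]; exact add_mem hx hy
    | hmul x y hx hy => intro z hz; rw [mul_assoc]; exact hx _ (hy z hz)
    | hadd x y hx hy => intro z hz; rw [add_mul]; exact add_mem (hx z hz) (hy z hz)
  refine eq_top_iff.mpr fun x _ => ?_
  simpa using key x 1 (Submodule.mem_iSup_of_mem 0 one_mem_stdSpan)

end StandardMonomials

section Residue

variable {ℓ n : ℕ}

theorem exists_forget (ℓ n : ℕ) : ∃ φ : A ℓ n →ₐ[ℂ] A (ℓ + 1) n,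
    ∀ i j, Valid ℓ n i j → φ (a ℓ n i j) = a (ℓ + 1) n i j := by
  refine exists_lift _ (fun _ _ _ _ _ _ => a_anticomm ..) (fun i j k hi hij hjk hk hj => ?_)
    (fun _ _ _ hi hij hj hk hkn => ?_)
  · rcases hj.eq_or_lt with rfl | hj
    · rw [a_mul_eq_zero hi hij le_rfl hjk hk, a_of_not_valid (i := i) (j := ℓ + 1)]
      · simp
      · unfold Valid; omega
    · exact a_arnold hi hij hjk hk hj
  · rcases Nat.succ_le_of_lt hk |>.eq_or_lt with rfl | hk
    · rw [a_of_not_valid, zero_mul]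
      unfold Valid; omega
    · exact a_mul_eq_zero hi hij (by omega) hk hkn

/-- The projection `π : A ℓ n → A (ℓ + 1) n`, killing the `a i (ℓ + 1)`. -/
noncomputable def forget (ℓ n : ℕ) : A ℓ n →ₐ[ℂ] A (ℓ + 1) n := (exists_forget ℓ n).choose

theorem forget_a (i j : ℕ) : forget ℓ n (a ℓ n i j) = a (ℓ + 1) n i j := by
  by_cases hv : Valid ℓ n i j
  · exact (exists_forget ℓ n).choose_spec i j hv
  · rw [a_of_not_valid hv, a_of_not_valid, map_zero]
    unfold Valid at *; omega

theorem forget_incl (x : A ℓ n) : forget ℓ (n + 1) (incl ℓ n x) = incl (ℓ + 1) n (forget ℓ n x) :=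
  algHom_eq_of_a (φ := (forget ℓ (n + 1)).comp (incl ℓ n))
    (ψ := (incl (ℓ + 1) n).comp (forget ℓ n))
    (fun i j hv => by
      rw [AlgHom.comp_apply, AlgHom.comp_apply, incl_a hv.2.2.2, forget_a, forget_a,
        incl_a hv.2.2.2]) x

/-- The residue along the hyperplane indexed by `(i, ℓ + 1)`. -/
theorem exists_residue (hn : ℓ + 1 ≤ n) (i : ℕ) :
    ∃ ρ : A ℓ n →ₗ[ℂ] A (ℓ + 1) n, ∀ j ∈ Finset.Icc 1 ℓ, ∀ x,
      ρ (a ℓ n j (ℓ + 1) * x) = if i = j then forget ℓ n x else 0 := by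
  induction n, hn using Nat.le_induction with
  | base =>
    obtain ⟨T, hT, -, hT2⟩ := exists_coords (le_refl ℓ)
    refine ⟨(forget ℓ (ℓ + 1)).toLinearMap ∘ₗ (incl ℓ ℓ).toLinearMap ∘ₗ LinearMap.proj i ∘ₗ
      LinearMap.snd ℂ _ _ ∘ₗ T, fun j hj x => ?_⟩
    have hsym : ∀ k l, symA ℓ ℓ k l = 0 := fun k l => by
      rw [symA, a_of_not_valid, a_of_not_valid, add_zero] <;> unfold Valid <;> omega
    have h0 : forget ℓ (ℓ + 1) (incl ℓ ℓ (T x).1) = forget ℓ (ℓ + 1) x := by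
      conv_rhs => rw [← hT x, assemble_apply, map_add, map_sum]
      rw [Finset.sum_eq_zero, add_zero]
      intro k _
      rw [map_mul, forget_a, a_of_not_valid, zero_mul]
      unfold Valid; omega
    simp [hT2 j hj, bAct, hsym, apply_ite (incl ℓ ℓ), apply_ite (forget ℓ (ℓ + 1)), h0]
  | succ n hn ih =>
    obtain ⟨ρ, hρ⟩ := ih
    obtain ⟨T, hT, hT1, -⟩ := exists_coords (show ℓ ≤ n by omega)
    refine ⟨(incl (ℓ + 1) n).toLinearMap ∘ₗ ρ ∘ₗ LinearMap.fst ℂ _ _ ∘ₗ T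
      - ∑ k ∈ Finset.Icc 1 n, LinearMap.mulLeft ℂ (a (ℓ + 1) (n + 1) k (n + 1)) ∘ₗ
        (incl (ℓ + 1) n).toLinearMap ∘ₗ ρ ∘ₗ LinearMap.proj k ∘ₗ LinearMap.snd ℂ _ _ ∘ₗ T,
      fun j hj x => ?_⟩
    have hv : Valid ℓ n j (ℓ + 1) := by
      rw [Finset.mem_Icc] at hj
      unfold Valid; omega
    have hx : forget ℓ (n + 1) x = incl (ℓ + 1) n (forget ℓ n (T x).1) +
        ∑ k ∈ Finset.Icc 1 n,
          a (ℓ + 1) (n + 1) k (n + 1) * incl (ℓ + 1) n (forget ℓ n ((T x).2 k)) := by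
      conv_lhs => rw [← hT x, assemble_apply, map_add, map_sum]
      simp only [map_mul, forget_a, forget_incl]
    by_cases hij : i = j
    · simp [hT1 _ _ _ hv, dAct, hρ j hj, hij, hx]
    · simp [hT1 _ _ _ hv, dAct, hρ j hj, hij]

end Residue

section Kernel

variable {ℓ n : ℕ}

/-- `x - s (π x)` lies in the right ideal generated by the `aᵢ`, with control on degrees. -/
theorem exists_eq_sum_of_mem_stdSpan {s : A (ℓ + 1) n →ₗ[ℂ] A ℓ n}
    (hs : ∀ (J : Finset ℕ) (f : ℕ → ℕ), J ⊆ Finset.Icc (ℓ + 2) n →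
      (∀ j ∈ J, 1 ≤ f j ∧ f j < j) → (∀ j, j ∉ J → f j = 0) →
      s (aIJ (ℓ + 1) n J f) = aIJ ℓ n J f) {q : ℕ} {x : A ℓ n} (hx : x ∈ stdSpan ℓ n q) :
    ∃ η : Fin ℓ → A (ℓ + 1) n, (∀ i, η i ∈ Adeg (ℓ + 1) n (q - 1)) ∧
      x - s (forget ℓ n x) = ∑ i : Fin ℓ, a ℓ n (i.1 + 1) (ℓ + 1) * s (η i) := by
  refine Submodule.span_induction (p := fun x _ => ∃ η : Fin ℓ → A (ℓ + 1) n,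
      (∀ i, η i ∈ Adeg (ℓ + 1) n (q - 1)) ∧
      x - s (forget ℓ n x) = ∑ i : Fin ℓ, a ℓ n (i.1 + 1) (ℓ + 1) * s (η i))
    ?_ ⟨0, by simp⟩ ?_ ?_ hx
  · rintro _ ⟨J, f, hJ, rfl, hf, hf0, rfl⟩
    rw [map_aIJ (forget ℓ n) fun j _ => forget_a ..]
    by_cases hm : ℓ + 1 ∈ J
    · obtain ⟨K, hK, rfl⟩ : ∃ K, ℓ + 1 ∉ K ∧ J = insert (ℓ + 1) K :=
        ⟨J.erase (ℓ + 1), Finset.notMem_erase _ _, (Finset.insert_erase hm).symm⟩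
      have hK' : K ⊆ Finset.Icc (ℓ + 2) n := by
        intro j hj
        have := Finset.mem_Icc.mp (hJ (Finset.mem_insert_of_mem hj))
        have : j ≠ ℓ + 1 := fun h => hK (h ▸ hj)
        rw [Finset.mem_Icc]; omega
      have hlt : ∀ j ∈ K, ℓ + 1 < j := fun j hj => (Finset.mem_Icc.mp (hK' hj)).1
      have hfm := hf _ (Finset.mem_insert_self _ _)
      have hsK : s (aIJ (ℓ + 1) n K f) = aIJ ℓ n K f := by
        have h : ∀ j ∈ K, (fun j => if j ∈ K then f j else 0) j = f j := fun j hj => if_pos hj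
        rw [← aIJ_congr h, ← aIJ_congr h]
        refine hs K _ hK' (fun j hj => ?_) fun j hj => if_neg hj
        simpa [hj] using hf j (Finset.mem_insert_of_mem hj)
      refine ⟨Pi.single ⟨f (ℓ + 1) - 1, by omega⟩ (aIJ (ℓ + 1) n K f), fun i => ?_, ?_⟩
      · rw [Finset.card_insert_of_notMem hK, Nat.add_sub_cancel, Pi.single_apply]
        split_ifs
        · exact aIJ_mem_Adeg K f
        · exact zero_mem _
      · rw [Finset.sum_eq_single ⟨f (ℓ + 1) - 1, by omega⟩]
        · rw [Pi.single_eq_same, hsK, aIJ_insert_min f hlt, aIJ_insert_min f hlt,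
            a_of_not_valid (ℓ := ℓ + 1), zero_mul, map_zero, sub_zero, Nat.sub_add_cancel hfm.1]
          unfold Valid; omega
        · intro i _ hi
          rw [Pi.single_eq_of_ne hi, map_zero, mul_zero]
        · simp
    · refine ⟨0, by simp, ?_⟩
      rw [hs J f _ hf hf0]
      · simp
      · intro j hj
        have := Finset.mem_Icc.mp (hJ hj)
        have : j ≠ ℓ + 1 := fun h => hm (h ▸ hj)
        rw [Finset.mem_Icc]; omega
  · rintro x y _ _ ⟨η, hη, hx⟩ ⟨ζ, hζ, hy⟩
    refine ⟨η + ζ, fun i => add_mem (hη i) (hζ i), ?_⟩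
    simp only [map_add, Pi.add_apply, mul_add, Finset.sum_add_distrib, ← hx, ← hy]
    abel
  · rintro r x _ ⟨η, hη, hx⟩
    refine ⟨r • η, fun i => Submodule.smul_mem _ _ (hη i), ?_⟩
    simp only [map_smul, Pi.smul_apply, mul_smul_comm, ← Finset.smul_sum, ← hx, smul_sub]

theorem a_mul_eq_zero_of_forget_eq_zero (hn : ℓ < n) {s : A (ℓ + 1) n →ₗ[ℂ] A ℓ n}
    (hs : ∀ (J : Finset ℕ) (f : ℕ → ℕ), J ⊆ Finset.Icc (ℓ + 2) n →
      (∀ j ∈ J, 1 ≤ f j ∧ f j < j) → (∀ j, j ∉ J → f j = 0) →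
      s (aIJ (ℓ + 1) n J f) = aIJ ℓ n J f) {i : ℕ} (hi : i ∈ Finset.Icc 1 ℓ) {x : A ℓ n}
    (hx : forget ℓ n x = 0) : a ℓ n i (ℓ + 1) * x = 0 := by
  have haa : ∀ j ∈ Finset.Icc 1 ℓ, a ℓ n i (ℓ + 1) * a ℓ n j (ℓ + 1) = 0 := by
    intro j hj
    rw [Finset.mem_Icc] at hi hj
    rcases lt_trichotomy i j with h | rfl | h
    · exact a_mul_eq_zero hi.1 h hj.2 (by omega) hn
    · exact a_mul_self ..
    · rw [a_anticomm, a_mul_eq_zero hj.1 h hi.2 (by omega) hn, neg_zero]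
  have key : ∀ x ∈ ⨆ q, stdSpan ℓ n q, a ℓ n i (ℓ + 1) * (x - s (forget ℓ n x)) = 0 := by
    intro x hx
    refine Submodule.iSup_induction
      (motive := fun x => a ℓ n i (ℓ + 1) * (x - s (forget ℓ n x)) = 0) _ hx
      (fun q x hx => ?_) (by simp) (fun x y hx hy => ?_)
    · obtain ⟨η, -, h⟩ := exists_eq_sum_of_mem_stdSpan hs hx
      rw [h, Finset.mul_sum]
      refine Finset.sum_eq_zero fun j _ => ?_
      rw [← mul_assoc, haa _ (by rw [Finset.mem_Icc]; omega), zero_mul]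
    · rw [map_add, map_add, add_sub_add_comm, mul_add, hx, hy, add_zero]
  have := key x (by rw [iSup_stdSpan hn.le]; trivial)
  rwa [hx, map_zero, sub_zero] at this

theorem forget_section (hn : ℓ < n) {s : A (ℓ + 1) n →ₗ[ℂ] A ℓ n}
    (hs : ∀ (J : Finset ℕ) (f : ℕ → ℕ), J ⊆ Finset.Icc (ℓ + 2) n →
      (∀ j ∈ J, 1 ≤ f j ∧ f j < j) → (∀ j, j ∉ J → f j = 0) →
      s (aIJ (ℓ + 1) n J f) = aIJ ℓ n J f) (x : A (ℓ + 1) n) : forget ℓ n (s x) = x := by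
  have hle : ⨆ q, stdSpan (ℓ + 1) n q
      ≤ LinearMap.eqLocus ((forget ℓ n).toLinearMap ∘ₗ s) LinearMap.id := by
    refine iSup_le fun q => Submodule.span_le.mpr ?_
    rintro _ ⟨J, f, hJ, -, hf, hf0, rfl⟩
    change forget ℓ n (s _) = _
    rw [hs J f hJ hf hf0]
    exact map_aIJ _ fun j _ => forget_a ..
  rw [iSup_stdSpan hn] at hle
  exact hle (Submodule.mem_top (x := x))

theorem section_mem_Adeg (hn : ℓ < n) {s : A (ℓ + 1) n →ₗ[ℂ] A ℓ n}
    (hs : ∀ (J : Finset ℕ) (f : ℕ → ℕ), J ⊆ Finset.Icc (ℓ + 2) n →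
      (∀ j ∈ J, 1 ≤ f j ∧ f j < j) → (∀ j, j ∉ J → f j = 0) →
      s (aIJ (ℓ + 1) n J f) = aIJ ℓ n J f) {q : ℕ} {x : A (ℓ + 1) n}
    (hx : x ∈ Adeg (ℓ + 1) n q) : s x ∈ Adeg ℓ n q := by
  have hle : stdSpan (ℓ + 1) n q ≤ (Adeg ℓ n q).comap s := by
    refine Submodule.span_le.mpr ?_
    rintro _ ⟨J, f, hJ, rfl, hf, hf0, rfl⟩
    change s _ ∈ Adeg ℓ n J.card
    rw [hs J f hJ hf hf0]
    exact aIJ_mem_Adeg J f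
  exact hle (Adeg_le_stdSpan hn q hx)

theorem forget_omega (hn : ℓ < n) (lam : ℕ × ℕ → ℂ) :
    forget ℓ n (omega ℓ n lam) = omega (ℓ + 1) n lam := by
  simp only [omega, map_sum, map_smul, forget_a]
  rw [← Finset.insert_Icc_add_one_left_eq_Icc (show ℓ + 1 ≤ n from hn),
    Finset.sum_insert (by simp), Finset.sum_eq_zero, zero_add]
  intro i _
  rw [a_of_not_valid, smul_zero]
  unfold Valid; omega

theorem omega_anticomm_a (lam : ℕ × ℕ → ℂ) (k l : ℕ) :
    omega ℓ n lam * a ℓ n k l = -(a ℓ n k l * omega ℓ n lam) := by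
  simp only [omega, Finset.sum_mul, Finset.mul_sum, ← Finset.sum_neg_distrib, smul_mul_assoc,
    mul_smul_comm, ← smul_neg, ← a_anticomm]

end Kernel

/-- The kernel subcomplex B^• = ker π ∩ A^• is isomorphic, via
    Φ^q(η₁,…,η_ℓ) = Σ_i a_{i,ℓ+1} ∧ s(η_i), to the direct sum of ℓ copies of the
    complex (Â^{•−1}, ω̂_λ∧·) with the sign of the differential reversed. -/
theorem statement8 (ℓ n : ℕ) (hℓ : 1 ≤ ℓ) (hn : ℓ < n)
    (π : A ℓ n →ₐ[ℂ] A (ℓ + 1) n)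
    (hπ1 : ∀ i, 1 ≤ i → i ≤ ℓ → π (a ℓ n i (ℓ + 1)) = 0)
    (hπ2 : ∀ i j, ℓ + 2 ≤ j → j ≤ n → 1 ≤ i → i < j →
      π (a ℓ n i j) = a (ℓ + 1) n i j)
    (s : A (ℓ + 1) n →ₗ[ℂ] A ℓ n)
    (hs : ∀ (J : Finset ℕ) (f : ℕ → ℕ), J ⊆ Finset.Icc (ℓ + 2) n →
      (∀ j ∈ J, 1 ≤ f j ∧ f j < j) → (∀ j, j ∉ J → f j = 0) →
      s (aIJ (ℓ + 1) n J f) = aIJ ℓ n J f)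
    (q : ℕ) (hq1 : 1 ≤ q) (hq2 : q ≤ n - ℓ) :
    (∀ η η' : Fin ℓ → A (ℓ + 1) n,
      (∀ i, η i ∈ Adeg (ℓ + 1) n (q - 1)) → (∀ i, η' i ∈ Adeg (ℓ + 1) n (q - 1)) →
      (∑ i : Fin ℓ, a ℓ n (i.1 + 1) (ℓ + 1) * s (η i))
        = (∑ i : Fin ℓ, a ℓ n (i.1 + 1) (ℓ + 1) * s (η' i)) →
      η = η') ∧
    ({x : A ℓ n | ∃ η : Fin ℓ → A (ℓ + 1) n,
        (∀ i, η i ∈ Adeg (ℓ + 1) n (q - 1)) ∧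
        x = ∑ i : Fin ℓ, a ℓ n (i.1 + 1) (ℓ + 1) * s (η i)}
      = {x : A ℓ n | π x = 0 ∧ x ∈ Adeg ℓ n q}) ∧
    (∀ (lam : ℕ × ℕ → ℂ) (η : Fin ℓ → A (ℓ + 1) n),
      (∀ i, η i ∈ Adeg (ℓ + 1) n (q - 1)) →
      omega ℓ n lam * (∑ i : Fin ℓ, a ℓ n (i.1 + 1) (ℓ + 1) * s (η i))
        = ∑ i : Fin ℓ, a ℓ n (i.1 + 1) (ℓ + 1) * s (-(omega (ℓ + 1) n lam * η i))) := by
  have hπ : ∀ x, π x = forget ℓ n x := algHom_eq_of_a fun i j ⟨h1, h2, h3, h4⟩ => by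
    rw [forget_a]
    rcases h3.eq_or_lt with rfl | h3
    · rw [hπ1 i h1 (by omega), a_of_not_valid]
      unfold Valid; omega
    · exact hπ2 i j h3 h4 h1 h2
  have hmem : ∀ i : Fin ℓ, i.1 + 1 ∈ Finset.Icc 1 ℓ := fun i => by rw [Finset.mem_Icc]; omega
  have hforget : ∀ η : Fin ℓ → A (ℓ + 1) n,
      forget ℓ n (∑ i : Fin ℓ, a ℓ n (i.1 + 1) (ℓ + 1) * s (η i)) = 0 := by
    intro η
    rw [map_sum]
    refine Finset.sum_eq_zero fun i _ => ?_
    rw [map_mul, forget_a, a_of_not_valid, zero_mul]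
    unfold Valid; omega
  refine ⟨fun η η' _ _ h => funext fun i => ?_, Set.ext fun x => ⟨?_, ?_⟩, fun lam η _ => ?_⟩
  · obtain ⟨ρ, hρ⟩ := exists_residue hn (i.1 + 1)
    have hsum : ∀ ζ : Fin ℓ → A (ℓ + 1) n,
        ρ (∑ j : Fin ℓ, a ℓ n (j.1 + 1) (ℓ + 1) * s (ζ j)) = ζ i := by
      intro ζ
      rw [map_sum, Finset.sum_eq_single i]
      · rw [hρ _ (hmem i), if_pos rfl, forget_section hn hs]
      · intro j _ hj
        rw [hρ _ (hmem j), if_neg fun hij => hj (Fin.ext (by omega))]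
      · simp
    rw [← hsum η, h, hsum]
  · rintro ⟨η, hη, rfl⟩
    refine ⟨by rw [hπ, hforget], sum_mem fun i _ => ?_⟩
    have := a_mul_mem_Adeg (i.1 + 1) (ℓ + 1) (section_mem_Adeg hn hs (hη i))
    rwa [Nat.sub_add_cancel hq1] at this
  · rintro ⟨hx, hxq⟩
    obtain ⟨η, hη, h⟩ := exists_eq_sum_of_mem_stdSpan hs (Adeg_le_stdSpan hn.le q hxq)
    rw [← hπ, hx, map_zero, sub_zero] at h
    exact ⟨η, hη, h⟩
  · rw [Finset.mul_sum]
    refine Finset.sum_congr rfl fun i _ => ?_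
    have h := a_mul_eq_zero_of_forget_eq_zero hn hs (hmem i)
      (x := omega ℓ n lam * s (η i) - s (omega (ℓ + 1) n lam * η i)) (by
        rw [map_sub, map_mul, forget_omega hn, forget_section hn hs, forget_section hn hs,
          sub_self])
    rw [mul_sub, sub_eq_zero] at h
    rw [map_neg, mul_neg, ← h, ← mul_assoc, omega_anticomm_a, neg_mul, mul_assoc]

end OSDisc
end

section
/- With J = {j₁ < ⋯ < j_q} ⊆ {ℓ+2,…,n}, I = (i₁,…,i_q), and 1 ≤ m ≤ ℓ as in the context: P_m(ω_{j_q,λ} ∧ a_{I,J}) = Σ_K λ_{k_q,j_q} · a_{m,ℓ+1}∧b_{j₁}∧⋯∧b_{j_q}, where the sum is over all I-admissible sets K, and where b_{j_p} = a_{i_p,j_p} − a_{k_p,j_p} if p is one of the positions s₁,…,s_t,q of K (with k_p the value of K at position p), and b_{j_p} = a_{i_p,j_p} otherwise. -/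
namespace OSDisc

/-- a_{I,J} for J presented as a strictly increasing tuple j and I as a tuple i:
    the ordered product a_{i₁,j₁}∧⋯∧a_{i_q,j_q}. -/
noncomputable def aTup (ℓ n : ℕ) {q : ℕ} (j i : Fin q → ℕ) : A ℓ n :=
  (List.ofFn fun p => a ℓ n (i p) (j p)).prod

/-- An I-admissible set (relative to the data j, i, m, ℓ, with final position P):
    distinct positions s₀,…,s_{t−1} < P together with the final position s_t = P,
    and values k_p with 1 ≤ k_p < j_{s_p}, k_p ≠ i_{s_p}, satisfying
    {k₀, i_{s₀}} = {m, ℓ+1} and {k_p, i_{s_p}} = {k_{p−1}, j_{s_{p−1}}}. -/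
structure Adm (ℓ m : ℕ) {q : ℕ} (j i : Fin q → ℕ) (P : Fin q) : Type where
  t : ℕ
  s : Fin (t + 1) → Fin q
  k : Fin (t + 1) → ℕ
  inj : Function.Injective s
  last_eq : s (Fin.last t) = P
  pos_lt : ∀ p, p ≠ Fin.last t → s p < P
  val_pos : ∀ p, 1 ≤ k p
  val_lt : ∀ p, k p < j (s p)
  val_ne : ∀ p, k p ≠ i (s p)
  first : ({k 0, i (s 0)} : Set ℕ) = {m, ℓ + 1}
  chain : ∀ p : Fin t,
    ({k p.succ, i (s p.succ)} : Set ℕ) = {k p.castSucc, j (s p.castSucc)}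

/-- p is a position of the admissible set K. -/
def Adm.IsPos {ℓ m q : ℕ} {j i : Fin q → ℕ} {P : Fin q}
    (K : Adm ℓ m j i P) (p : Fin q) : Prop :=
  ∃ r, K.s r = p

/-- The value of the admissible set K at the position p (0 if p is not a position). -/
noncomputable def Adm.val {ℓ m q : ℕ} {j i : Fin q → ℕ} {P : Fin q}
    (K : Adm ℓ m j i P) (p : Fin q) : ℕ :=
  if h : ∃ r, K.s r = p then K.k h.choose else 0



open Classical in
/-- The factor b_{j_p} associated to an admissible set K. -/
noncomputable def bfun (ℓ n : ℕ) {m q : ℕ} (j i : Fin q → ℕ) {P : Fin q}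
    (K : Adm ℓ m j i P) (p : Fin q) : A ℓ n :=
  if K.IsPos p then a ℓ n (i p) (j p) - a ℓ n (K.val p) (j p)
  else a ℓ n (i p) (j p)

section Algebra

variable {ℓ n : ℕ}

theorem a_mul_a_swap (i j i' j' : ℕ) :
    a ℓ n i j * a ℓ n i' j' = -(a ℓ n i' j' * a ℓ n i j) := by
  rw [eq_neg_iff_add_eq_zero, a, a, ← map_mul, ← map_mul, ← map_add]
  have h : gen ℓ n i j * gen ℓ n i' j' + gen ℓ n i' j' * gen ℓ n i j = 0 := by
    unfold gen
    split_ifs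
    · exact ExteriorAlgebra.ι_add_mul_swap _ _
    all_goals simp
  rw [h, map_zero]

theorem a_mul_a_of_lt {u v w : ℕ} (hu : 1 ≤ u) (huv : u < v) (hvw : v < w) (hw : w ≤ n)
    (hv : ℓ < v) :
    a ℓ n u w * a ℓ n v w = a ℓ n u v * (a ℓ n v w - a ℓ n u w) := by
  have h := RingQuot.mkAlgHom_rel ℂ (s := rel ℓ n)
    (show rel ℓ n _ 0 from ⟨rfl, Or.inl ⟨u, v, w, hu, huv, hvw, hw, hv, rfl⟩⟩)
  have h' : a ℓ n u v * a ℓ n u w - a ℓ n u v * a ℓ n v w + a ℓ n u w * a ℓ n v w = 0 := by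
    simpa [a, projA] using h
  rw [mul_sub, ← sub_eq_zero, ← h']
  abel

theorem a_mul_a_of_le {u v w : ℕ} (hu : 1 ≤ u) (huv : u < v) (hv : v ≤ ℓ) (hℓw : ℓ < w)
    (hw : w ≤ n) : a ℓ n u w * a ℓ n v w = 0 := by
  have h := RingQuot.mkAlgHom_rel ℂ (s := rel ℓ n)
    (show rel ℓ n _ 0 from ⟨rfl, Or.inr ⟨u, v, w, hu, huv, hv, hℓw, hw, rfl⟩⟩)
  simpa [a, projA] using h

/-- The product of two distinct generators in the same column, expressed through the
ordered pair `u < v` of their row indices. -/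
theorem exists_pair_mul {k i w : ℕ} (hk : 1 ≤ k) (hkw : k < w) (hi : 1 ≤ i) (hiw : i < w)
    (hki : k ≠ i) (hℓw : ℓ < w) (hw : w ≤ n) :
    ∃ u v, 1 ≤ u ∧ u < v ∧ v < w ∧ ({k, i} : Set ℕ) = {u, v} ∧
      (v ≤ ℓ → a ℓ n k w * a ℓ n i w = 0) ∧
      (ℓ < v → a ℓ n k w * a ℓ n i w = a ℓ n u v * (a ℓ n i w - a ℓ n k w)) := by
  rcases lt_or_gt_of_ne hki with h | h
  · exact ⟨k, i, hk, h, hiw, rfl, fun hv => a_mul_a_of_le hk h hv hℓw hw,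
      fun hv => a_mul_a_of_lt hk h hiw hw hv⟩
  · refine ⟨i, k, hi, h, hkw, Set.pair_comm _ _, fun hv => ?_, fun hv => ?_⟩
    · rw [a_mul_a_swap, a_mul_a_of_le hi h hv hℓw hw, neg_zero]
    · rw [a_mul_a_swap, a_mul_a_of_lt hi h hkw hw hv, ← mul_neg, neg_sub]

/-- The span of the generators `a_{r,w}` with second index `w`. -/
noncomputable def col (ℓ n w : ℕ) : Submodule ℂ (A ℓ n) :=
  Submodule.span ℂ ((fun r => a ℓ n r w) '' Set.Ico 1 w)

theorem a_mem_col {r w : ℕ} (hr : 1 ≤ r) (hrw : r < w) : a ℓ n r w ∈ col ℓ n w :=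
  Submodule.subset_span ⟨r, ⟨hr, hrw⟩, rfl⟩

theorem a_mul_swap_of_mem_col {w : ℕ} {x : A ℓ n} (hx : x ∈ col ℓ n w) (i j : ℕ) :
    a ℓ n i j * x = -(x * a ℓ n i j) := by
  induction hx using Submodule.span_induction with
  | mem x hx =>
    obtain ⟨r, -, rfl⟩ := hx
    exact a_mul_a_swap _ _ _ _
  | zero => simp
  | add x y _ _ hx hy => rw [mul_add, add_mul, hx, hy, neg_add]
  | smul c x _ hx => rw [mul_smul_comm, smul_mul_assoc, hx, smul_neg]

end Algebra

theorem mul_prod_ofFn_eq {R : Type*} [Ring R] {y z : R} {N : ℕ} (c c' : Fin N → R) (s : Fin N)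
    (hc : ∀ p, p ≠ s → c' p = c p) (hy : ∀ p, y * c p = -(c p * y))
    (hz : ∀ p, z * c p = -(c p * z)) (hs : y * c s = z * c' s) :
    y * (List.ofFn c).prod = z * (List.ofFn c').prod := by
  induction N with
  | zero => exact s.elim0
  | succ N ih =>
    rw [List.ofFn_succ, List.ofFn_succ, List.prod_cons, List.prod_cons]
    cases s using Fin.cases with
    | zero =>
      have h : (fun p : Fin N => c' p.succ) = fun p => c p.succ :=
        funext fun p => hc _ (Fin.succ_ne_zero p)
      rw [h, ← mul_assoc, hs, mul_assoc]
    | succ s =>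
      rw [hc 0 (Fin.succ_ne_zero s).symm, ← mul_assoc, ← mul_assoc, hy, hz, neg_mul, neg_mul,
        mul_assoc, mul_assoc,
        ih (fun p => c p.succ) (fun p => c' p.succ) s
          (fun p hp => hc _ (by simpa using hp)) (fun p => hy _) (fun p => hz _) hs]

theorem mul_prod_ofFn_eq_zero {R : Type*} [Ring R] {y : R} {N : ℕ} (c : Fin N → R) (s : Fin N)
    (hy : ∀ p, y * c p = -(c p * y)) (hs : y * c s = 0) : y * (List.ofFn c).prod = 0 := by
  rw [mul_prod_ofFn_eq (z := 0) c c s (fun _ _ => rfl) hy (by simp) (by simp [hs]), zero_mul]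

theorem prod_ofFn_mem_span {R : Type*} [Ring R] [Algebra ℂ R] {N : ℕ} (S : Fin N → Set R)
    (c : Fin N → R) (hc : ∀ p, c p ∈ Submodule.span ℂ (S p)) :
    (List.ofFn c).prod ∈
      Submodule.span ℂ {y | ∃ d : Fin N → R, (∀ p, d p ∈ S p) ∧ y = (List.ofFn d).prod} := by
  induction N with
  | zero => exact Submodule.subset_span ⟨c, fun p => p.elim0, rfl⟩
  | succ N ih =>
    rw [List.ofFn_succ, List.prod_cons]
    have h := Submodule.mul_mem_mul (hc 0) (ih (fun p => S p.succ) _ fun p => hc p.succ)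
    rw [Submodule.span_mul_span] at h
    refine Submodule.span_mono ?_ h
    rintro _ ⟨x, hx, _, ⟨d, hd, rfl⟩, rfl⟩
    refine ⟨Fin.cons x d, fun p => ?_, by simp [List.ofFn_succ]⟩
    cases p using Fin.cases with
    | zero => simpa using hx
    | succ p => simpa using hd p

theorem exists_smul_prod_of_perm {ι R : Type*} [Ring R] [Algebra ℂ R] (f : ι → R)
    (hf : ∀ x y, f x * f y = -(f y * f x)) {l l' : List ι} (h : l.Perm l') :
    ∃ ε : ℂ, (l.map f).prod = ε • (l'.map f).prod := by
  induction h with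
  | nil => exact ⟨1, by simp⟩
  | cons x _ ih =>
    obtain ⟨ε, hε⟩ := ih
    exact ⟨ε, by simp [hε]⟩
  | swap x y l => exact ⟨-1, by simp [← mul_assoc, hf y x]⟩
  | trans _ _ ih ih' =>
    obtain ⟨ε, hε⟩ := ih
    obtain ⟨ε', hε'⟩ := ih'
    exact ⟨ε * ε', by rw [hε, hε', smul_smul]⟩

section Projection

variable {ℓ n N : ℕ} {j : Fin N → ℕ}

theorem exists_a_mul_prod_eq_smul_aIJ (hj : Function.Injective j) {v : ℕ} (hv : ∀ p, j p ≠ v)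
    (g : ℕ → ℕ) :
    ∃ ε : ℂ, a ℓ n (g v) v * (List.ofFn fun p => a ℓ n (g (j p)) (j p)).prod
      = ε • aIJ ℓ n (insert v (Finset.image j Finset.univ)) g := by
  have hperm : (v :: List.ofFn j).Perm
      ((insert v (Finset.image j Finset.univ)).sort (· ≤ ·)) := by
    refine List.perm_of_nodup_nodup_toFinset_eq ?_ (Finset.sort_nodup _ _) ?_
    · rw [List.nodup_cons]
      exact ⟨by simpa [List.mem_ofFn] using hv, List.nodup_ofFn.2 hj⟩
    · ext x
      simp [List.mem_ofFn]
  obtain ⟨ε, hε⟩ := exists_smul_prod_of_perm (fun x => a ℓ n (g x) x)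
    (fun x y => a_mul_a_swap _ _ _ _) hperm
  refine ⟨ε, ?_⟩
  rw [aIJ, ← hε, List.map_cons, List.prod_cons, List.map_ofFn]
  rfl

theorem map_a_mul_prod_eq_of_basis (F G : A ℓ n →ₗ[ℂ] A ℓ n) (hj : Function.Injective j)
    (hjn : ∀ p, ℓ + 1 ≤ j p ∧ j p ≤ n)
    {u v : ℕ} (hu : 1 ≤ u) (huv : u < v) (hℓv : ℓ + 1 ≤ v) (hvn : v ≤ n) (hv : ∀ p, j p ≠ v)
    (hFG : ∀ g : ℕ → ℕ,
      insert v (Finset.image j Finset.univ) ⊆ Finset.Icc (ℓ + 1) n →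
      (∀ x ∈ insert v (Finset.image j Finset.univ), 1 ≤ g x ∧ g x < x) →
      (∀ x ∉ insert v (Finset.image j Finset.univ), g x = 0) → g v = u →
      F (aIJ ℓ n (insert v (Finset.image j Finset.univ)) g)
        = G (aIJ ℓ n (insert v (Finset.image j Finset.univ)) g))
    (c : Fin N → A ℓ n) (hc : ∀ p, c p ∈ col ℓ n (j p)) :
    F (a ℓ n u v * (List.ofFn c).prod) = G (a ℓ n u v * (List.ofFn c).prod) := by
  have hspan := prod_ofFn_mem_span _ c hc
  generalize (List.ofFn c).prod = z at hspan ⊢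
  induction hspan using Submodule.span_induction with
  | zero => simp
  | add x y _ _ hx hy => rw [mul_add, map_add, map_add, hx, hy]
  | smul t x _ hx => rw [mul_smul_comm, map_smul, map_smul, hx]
  | mem x hx =>
    obtain ⟨d, hd, rfl⟩ := hx
    choose r hr hrd using hd
    classical
    set g : ℕ → ℕ := fun x => if x = v then u else if h : ∃ p, j p = x then r h.choose else 0
      with hg
    have hgv : g v = u := by simp [hg]
    have hgj : ∀ p, g (j p) = r p := by
      intro p
      have h : ∃ p', j p' = j p := ⟨p, rfl⟩
      simp only [hg, hv p, if_false, dif_pos h]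
      rw [hj h.choose_spec]
    have hd' : d = fun p => a ℓ n (g (j p)) (j p) := by
      funext p
      rw [hgj, ← hrd p]
    obtain ⟨ε, hε⟩ := exists_a_mul_prod_eq_smul_aIJ (ℓ := ℓ) (n := n) hj hv g
    rw [hgv, ← hd'] at hε
    rw [hε, map_smul, map_smul, hFG g ?_ ?_ ?_ hgv]
    · intro x hx
      rw [Finset.mem_insert, Finset.mem_image] at hx
      rw [Finset.mem_Icc]
      rcases hx with rfl | ⟨p, -, rfl⟩
      · exact ⟨hℓv, hvn⟩
      · exact hjn p
    · intro x hx
      rw [Finset.mem_insert, Finset.mem_image] at hx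
      rcases hx with rfl | ⟨p, -, rfl⟩
      · rw [hgv]
        exact ⟨hu, huv⟩
      · rw [hgj]
        exact hr p
    · intro x hx
      rw [Finset.mem_insert, Finset.mem_image] at hx
      push Not at hx
      have h : ¬∃ p, j p = x := fun ⟨p, hp⟩ => hx.2 p (Finset.mem_univ _) hp
      simp [hg, hx.1, h]

end Projection

theorem eq_and_eq_of_pair_eq_of_lt {u v u' v' : ℕ} (h : ({u, v} : Set ℕ) = {u', v'})
    (huv : u < v) (huv' : u' < v') : u = u' ∧ v = v' := by
  rw [Set.pair_eq_pair_iff] at h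
  omega

namespace Adm

variable {ℓ m q : ℕ} {j i : Fin q → ℕ} {P : Fin q}

theorem val_eq_of_s_eq (K : Adm ℓ m j i P) {r : Fin (K.t + 1)} {p : Fin q} (hr : K.s r = p) :
    K.val p = K.k r := by
  have h : ∃ r', K.s r' = p := ⟨r, hr⟩
  rw [val, dif_pos h, K.inj (h.choose_spec.trans hr.symm)]

theorem val_last (K : Adm ℓ m j i P) : K.val P = K.k (Fin.last K.t) :=
  K.val_eq_of_s_eq K.last_eq

theorem k_last_lt (K : Adm ℓ m j i P) : K.k (Fin.last K.t) < j P := by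
  have h := K.val_lt (Fin.last K.t)
  rwa [K.last_eq] at h

theorem s_le (K : Adm ℓ m j i P) (r : Fin (K.t + 1)) : K.s r ≤ P := by
  by_cases h : r = Fin.last K.t
  · rw [h, K.last_eq]
  · exact (K.pos_lt r h).le

/-- The admissible set with a single position. -/
def single {k : ℕ} (hk : 1 ≤ k) (hkP : k < j P) (hki : k ≠ i P)
    (h : ({k, i P} : Set ℕ) = {m, ℓ + 1}) : Adm ℓ m j i P where
  t := 0
  s := fun _ => P
  k := fun _ => k
  inj := fun _ _ _ => Fin.ext (by omega)
  last_eq := rfl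
  pos_lt := fun p hp => absurd (Fin.ext (by omega)) hp
  val_pos := fun _ => hk
  val_lt := fun _ => hkP
  val_ne := fun _ => hki
  first := h
  chain := fun p => p.elim0

/-- Extension of an admissible set by a later final position. -/
def snoc (K : Adm ℓ m j i P) {Q : Fin q} (hPQ : P < Q) {k : ℕ} (hk : 1 ≤ k) (hkQ : k < j Q)
    (hki : k ≠ i Q) (h : ({k, i Q} : Set ℕ) = {K.k (Fin.last K.t), j P}) : Adm ℓ m j i Q where
  t := K.t + 1
  s := Fin.snoc (α := fun _ => Fin q) K.s Q
  k := Fin.snoc (α := fun _ => ℕ) K.k k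
  inj := by
    have hlt : ∀ r, K.s r < Q := fun r => (K.s_le r).trans_lt hPQ
    intro x y
    cases x using Fin.lastCases <;> cases y using Fin.lastCases <;>
      simp [(hlt _).ne, (hlt _).ne', K.inj.eq_iff]
  last_eq := by simp
  pos_lt := by
    intro p hp
    cases p using Fin.lastCases with
    | last => exact absurd rfl hp
    | cast p => simpa using (K.s_le p).trans_lt hPQ
  val_pos := by
    intro p
    cases p using Fin.lastCases <;> simp [hk, K.val_pos]
  val_lt := by
    intro p
    cases p using Fin.lastCases <;> simp [hkQ, K.val_lt]
  val_ne := by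
    intro p
    cases p using Fin.lastCases <;> simp [hki, K.val_ne]
  first := by
    rw [← Fin.castSucc_zero, Fin.snoc_castSucc, Fin.snoc_castSucc]
    exact K.first
  chain := by
    intro p
    cases p using Fin.lastCases with
    | last =>
      rw [Fin.succ_last, Fin.snoc_last, Fin.snoc_last, Fin.snoc_castSucc, Fin.snoc_castSucc,
        K.last_eq]
      exact h
    | cast p =>
      rw [Fin.succ_castSucc]
      simp only [Fin.snoc_castSucc]
      exact K.chain p

section Snoc

variable (K : Adm ℓ m j i P) {Q : Fin q} (hPQ : P < Q) {k : ℕ} (hk : 1 ≤ k) (hkQ : k < j Q)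
  (hki : k ≠ i Q) (h : ({k, i Q} : Set ℕ) = {K.k (Fin.last K.t), j P})

theorem snoc_k_last :
    (K.snoc hPQ hk hkQ hki h).k (Fin.last (K.snoc hPQ hk hkQ hki h).t) = k :=
  Fin.snoc_last (α := fun _ => ℕ) _ _

theorem snoc_isPos_iff (p : Fin q) :
    (K.snoc hPQ hk hkQ hki h).IsPos p ↔ K.IsPos p ∨ p = Q := by
  constructor
  · rintro ⟨r, rfl⟩
    cases r using Fin.lastCases with
    | last => exact Or.inr (last_eq _)
    | cast r => exact Or.inl ⟨r, (Fin.snoc_castSucc (α := fun _ => Fin q) _ _ _).symm⟩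
  · rintro (⟨r, rfl⟩ | rfl)
    · exact ⟨r.castSucc, Fin.snoc_castSucc (α := fun _ => Fin q) _ _ _⟩
    · exact ⟨_, last_eq _⟩

theorem snoc_val_of_isPos {p : Fin q} (hp : K.IsPos p) :
    (K.snoc hPQ hk hkQ hki h).val p = K.val p := by
  obtain ⟨r, rfl⟩ := hp
  have h1 : (K.snoc hPQ hk hkQ hki h).s r.castSucc = K.s r :=
    Fin.snoc_castSucc (α := fun _ => Fin q) _ _ _
  rw [val_eq_of_s_eq _ h1, K.val_eq_of_s_eq rfl]
  exact Fin.snoc_castSucc (α := fun _ => ℕ) _ _ _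

end Snoc

theorem strictMono_s (hj : StrictMono j) (hi : ∀ p, i p < j p) (K : Adm ℓ m j i P) :
    StrictMono K.s := by
  rw [Fin.strictMono_iff_lt_succ]
  intro r
  rw [← hj.lt_iff_lt]
  have h := K.chain r
  have h1 := K.val_lt r.succ
  have h2 := hi (K.s r.succ)
  rw [Set.pair_eq_pair_iff] at h
  omega

/-- An admissible set either has a single position or extends one with an earlier final
position. -/
theorem exists_init (hj : StrictMono j) (hi : ∀ p, i p < j p) (K : Adm ℓ m j i P) :
    ({K.k (Fin.last K.t), i P} : Set ℕ) = {m, ℓ + 1} ∨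
      ∃ Q, ∃ K' : Adm ℓ m j i Q,
        ({K.k (Fin.last K.t), i P} : Set ℕ) = {K'.k (Fin.last K'.t), j Q} := by
  have hmono := K.strictMono_s hj hi
  obtain ⟨t, s, k, inj, last_eq, pos_lt, val_pos, val_lt, val_ne, first, chain⟩ := K
  subst last_eq
  cases t with
  | zero => exact Or.inl first
  | succ t =>
    right
    refine ⟨s (Fin.last t).castSucc, ⟨t, fun r => s r.castSucc, fun r => k r.castSucc,
      fun x y hxy => Fin.castSucc_injective _ (inj hxy), rfl, fun p hp => hmono ?_,
      fun p => val_pos _, fun p => val_lt _, fun p => val_ne _, first,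
      fun p => chain p.castSucc⟩, ?_⟩
    · exact Fin.castSucc_lt_castSucc_iff.2 (Fin.lt_last_iff_ne_last.2 hp)
    · exact chain (Fin.last t)

theorem eq_of_chain (hj : StrictMono j) (hj2 : ∀ p, ℓ + 2 ≤ j p) (hm : m ≤ ℓ) (t : ℕ) :
    ∀ (t' : ℕ) (s : Fin (t + 1) → Fin q) (k : Fin (t + 1) → ℕ) (s' : Fin (t' + 1) → Fin q)
      (k' : Fin (t' + 1) → ℕ), (∀ p, k p < j (s p)) → (∀ p, k' p < j (s' p)) →
      ({k 0, i (s 0)} : Set ℕ) = {m, ℓ + 1} → ({k' 0, i (s' 0)} : Set ℕ) = {m, ℓ + 1} →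
      (∀ p : Fin t, ({k p.succ, i (s p.succ)} : Set ℕ) = {k p.castSucc, j (s p.castSucc)}) →
      (∀ p : Fin t', ({k' p.succ, i (s' p.succ)} : Set ℕ)
        = {k' p.castSucc, j (s' p.castSucc)}) →
      s (Fin.last t) = s' (Fin.last t') → k (Fin.last t) = k' (Fin.last t') →
      t = t' ∧ ∀ (r : ℕ) (h : r < t + 1) (h' : r < t' + 1),
        s ⟨r, h⟩ = s' ⟨r, h'⟩ ∧ k ⟨r, h⟩ = k' ⟨r, h'⟩ := by
  have hfirst : ∀ {x : ℕ} (p : Fin q), x < j p → ({m, ℓ + 1} : Set ℕ) = {x, j p} → False := by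
    intro x p hx h
    have := hj2 p
    rw [Set.pair_eq_pair_iff] at h
    omega
  induction t with
  | zero =>
    intro t' s k s' k' hk hk' hf hf' hc hc' hs hkk
    cases t' with
    | zero =>
      refine ⟨rfl, fun r h h' => ?_⟩
      obtain rfl : r = 0 := by omega
      exact ⟨hs, hkk⟩
    | succ t' =>
      have h := hc' (Fin.last t')
      rw [Fin.succ_last, ← hs, ← hkk] at h
      exact (hfirst _ (hk' _) (hf.symm.trans h)).elim
  | succ t ih =>
    intro t' s k s' k' hk hk' hf hf' hc hc' hs hkk
    cases t' with
    | zero =>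
      have h := hc (Fin.last t)
      rw [Fin.succ_last, hs, hkk] at h
      exact (hfirst _ (hk _) (hf'.symm.trans h)).elim
    | succ t' =>
      have h := hc (Fin.last t)
      have h' := hc' (Fin.last t')
      rw [Fin.succ_last, hs, hkk] at h
      rw [Fin.succ_last] at h'
      obtain ⟨e1, e2⟩ := eq_and_eq_of_pair_eq_of_lt (h.symm.trans h') (hk _) (hk' _)
      obtain ⟨rfl, hr⟩ := ih t' (fun r => s r.castSucc) (fun r => k r.castSucc)
        (fun r => s' r.castSucc) (fun r => k' r.castSucc) (fun _ => hk _) (fun _ => hk' _) hf hf'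
        (fun p => hc p.castSucc) (fun p => hc' p.castSucc) (hj.injective e2) e1
      refine ⟨rfl, fun r h h' => ?_⟩
      rcases Nat.lt_succ_iff_lt_or_eq.1 h with hlt | rfl
      · exact hr r hlt hlt
      · exact ⟨hs, hkk⟩

theorem injective_k_last (hj : StrictMono j) (hj2 : ∀ p, ℓ + 2 ≤ j p) (hm : m ≤ ℓ) :
    Function.Injective fun K : Adm ℓ m j i P => K.k (Fin.last K.t) := by
  rintro ⟨t, s, k, _, hs, _, _, hk, _, hf, hc⟩ ⟨t', s', k', _, hs', _, _, hk', _, hf', hc'⟩ h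
  obtain ⟨rfl, hr⟩ := eq_of_chain hj hj2 hm t t' s k s' k' hk hk' hf hf' hc hc'
    (hs.trans hs'.symm) h
  obtain rfl : s = s' := funext fun r => (hr r r.2 r.2).1
  obtain rfl : k = k' := funext fun r => (hr r r.2 r.2).2
  rfl

end Adm

open Classical in
theorem exists_adm_or_map_eq_zero {ℓ n m q : ℕ} {j i : Fin q → ℕ} (hjmono : StrictMono j)
    (hj : ∀ p, ℓ + 2 ≤ j p ∧ j p ≤ n) (hi : ∀ p, 1 ≤ i p ∧ i p < j p) (hm : m ≤ ℓ)
    (P : A ℓ n →ₗ[ℂ] A ℓ n)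
    (hfix : ∀ c : Fin q → A ℓ n, (∀ p, c p ∈ col ℓ n (j p)) →
      P (a ℓ n m (ℓ + 1) * (List.ofFn c).prod) = a ℓ n m (ℓ + 1) * (List.ofFn c).prod)
    (hkill : ∀ u v, 1 ≤ u → u < v → ℓ + 1 ≤ v → v ≤ n → (∀ p, j p ≠ v) → ¬(v = ℓ + 1 ∧ u = m) →
      ∀ c : Fin q → A ℓ n, (∀ p, c p ∈ col ℓ n (j p)) →
        P (a ℓ n u v * (List.ofFn c).prod) = 0)
    (s : Fin q) (k : ℕ) (c : Fin q → A ℓ n) (hk : 1 ≤ k) (hks : k < j s) (hki : k ≠ i s)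
    (hc : ∀ p, c p ∈ col ℓ n (j p)) (hcs : ∀ p ≤ s, c p = a ℓ n (i p) (j p)) :
    (∃ K : Adm ℓ m j i s, K.k (Fin.last K.t) = k ∧
      P (a ℓ n k (j s) * (List.ofFn c).prod) = a ℓ n m (ℓ + 1) *
        (List.ofFn fun p => if K.IsPos p then a ℓ n (i p) (j p) - a ℓ n (K.val p) (j p)
          else c p).prod) ∨
    ((∀ K : Adm ℓ m j i s, K.k (Fin.last K.t) ≠ k) ∧
      P (a ℓ n k (j s) * (List.ofFn c).prod) = 0) := by
  induction s using WellFoundedLT.induction generalizing k c with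
  | _ s ih =>
  obtain ⟨u, v, hu, huv, hvs, hpair, hzero, hmul⟩ := exists_pair_mul (ℓ := ℓ) (n := n) hk hks
    (hi s).1 (hi s).2 hki (by have := (hj s).1; omega) (hj s).2
  have hanti : ∀ x y p, a ℓ n x y * c p = -(c p * a ℓ n x y) :=
    fun x y p => a_mul_swap_of_mem_col (hc p) _ _
  have hnone : (∀ Q, ∀ K' : Adm ℓ m j i Q, u = K'.k (Fin.last K'.t) → v ≠ j Q) →
      ¬(v = ℓ + 1 ∧ u = m) → ∀ K : Adm ℓ m j i s, K.k (Fin.last K.t) ≠ k := by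
    rintro h1 h2 K rfl
    rcases K.exists_init hjmono (fun p => (hi p).2) with h | ⟨Q, K', h⟩
    · rw [hpair] at h
      exact h2 (eq_and_eq_of_pair_eq_of_lt h huv (by omega)).symm
    · rw [hpair] at h
      obtain ⟨e1, e2⟩ := eq_and_eq_of_pair_eq_of_lt h huv K'.k_last_lt
      exact h1 Q K' e1 e2
  rcases Nat.lt_or_ge ℓ v with hv | hv
  swap
  · refine Or.inr ⟨hnone (fun Q _ _ hQ => ?_) (by omega), ?_⟩
    · have := (hj Q).1
      omega
    · rw [mul_prod_ofFn_eq_zero c s (hanti k (j s)) (by rw [hcs s le_rfl]; exact hzero hv),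
        map_zero]
  set c' := Function.update c s (a ℓ n (i s) (j s) - a ℓ n k (j s)) with hc'def
  have hc's : c' s = a ℓ n (i s) (j s) - a ℓ n k (j s) := Function.update_self _ _ _
  have hc'ne : ∀ p, p ≠ s → c' p = c p := fun p hp => Function.update_of_ne hp _ _
  have hc' : ∀ p, c' p ∈ col ℓ n (j p) := by
    intro p
    by_cases hp : p = s
    · subst hp
      rw [hc's]
      exact sub_mem (a_mem_col (hi p).1 (hi p).2) (a_mem_col hk hks)
    · rw [hc'ne p hp]
      exact hc p
  have hprod : a ℓ n k (j s) * (List.ofFn c).prod = a ℓ n u v * (List.ofFn c').prod :=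
    mul_prod_ofFn_eq c c' s hc'ne (hanti _ _) (hanti _ _)
      (by rw [hcs s le_rfl, hc's]; exact hmul hv)
  have hvn : v ≤ n := hvs.le.trans (hj s).2
  rw [hprod]
  by_cases hvu : v = ℓ + 1 ∧ u = m
  · obtain ⟨rfl, rfl⟩ := hvu
    refine Or.inl ⟨Adm.single hk hks hki hpair, rfl, ?_⟩
    rw [hfix c' hc']
    congr 3
    funext p
    by_cases hp : p = s
    · subst hp
      rw [if_pos ⟨_, Adm.last_eq _⟩, Adm.val_last, hc's]
      rfl
    · rw [if_neg, hc'ne p hp]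
      rintro ⟨_, h⟩
      exact hp h.symm
  by_cases hvj : ∃ Q, j Q = v
  swap
  · push Not at hvj
    exact Or.inr ⟨hnone (fun Q _ _ hQ => hvj Q hQ.symm) hvu, hkill u v hu huv hv hvn hvj hvu c' hc'⟩
  obtain ⟨Q, rfl⟩ := hvj
  have hQs : Q < s := hjmono.lt_iff_lt.1 hvs
  have hc'Q : ∀ p ≤ Q, c' p = a ℓ n (i p) (j p) := fun p hp => by
    rw [hc'ne p (hp.trans_lt hQs).ne, hcs p (hp.trans hQs.le)]
  by_cases hui : u = i Q
  · refine Or.inr ⟨hnone (fun Q' K' h1 h2 => ?_) hvu, ?_⟩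
    · obtain rfl := hjmono.injective h2
      have h := K'.val_ne (Fin.last K'.t)
      rw [K'.last_eq] at h
      exact h (h1.symm.trans hui)
    · rw [mul_prod_ofFn_eq_zero c' Q (fun p => a_mul_swap_of_mem_col (hc' p) _ _)
        (by rw [hc'Q Q le_rfl, hui, a_mul_self]), map_zero]
  rcases ih Q hQs u c' hu huv hui hc' hc'Q with ⟨K', rfl, hK'⟩ | ⟨hK', h0⟩
  · refine Or.inl ⟨K'.snoc hQs hk hks hki hpair, Adm.snoc_k_last .., ?_⟩
    rw [hK']
    congr 3
    funext p
    by_cases hp : K'.IsPos p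
    · rw [if_pos hp, if_pos ((Adm.snoc_isPos_iff ..).2 (Or.inl hp)),
        Adm.snoc_val_of_isPos _ _ _ _ _ _ hp]
    rw [if_neg hp]
    by_cases hps : p = s
    · subst hps
      rw [if_pos ((Adm.snoc_isPos_iff ..).2 (Or.inr rfl)), Adm.val_last, Adm.snoc_k_last, hc's]
    · rw [if_neg (fun h => ((Adm.snoc_isPos_iff ..).1 h).elim hp hps), hc'ne p hps]
  · refine Or.inr ⟨hnone (fun Q' K'' h1 h2 => ?_) hvu, h0⟩
    obtain rfl := hjmono.injective h2
    exact hK' K'' h1.symm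

/-- P_m(ω_{j_q,λ} ∧ a_{I,J}) = Σ_K λ_{k_q,j_q} · a_{m,ℓ+1}∧b_{j₁}∧⋯∧b_{j_q}, the sum
    over all I-admissible sets K.  (J has q+1 elements, final position Fin.last q.) -/
theorem statement9 (ℓ n : ℕ) (hℓ : 1 ≤ ℓ) (hn : ℓ < n) (q : ℕ)
    (j i : Fin (q + 1) → ℕ) (hjmono : StrictMono j)
    (hj : ∀ p, ℓ + 2 ≤ j p ∧ j p ≤ n) (hi : ∀ p, 1 ≤ i p ∧ i p < j p)
    (m : ℕ) (hm1 : 1 ≤ m) (hm2 : m ≤ ℓ) (lam : ℕ × ℕ → ℂ)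
    (P : A ℓ n →ₗ[ℂ] A ℓ n)
    (hP1 : ∀ (K : Finset ℕ) (g : ℕ → ℕ), K ⊆ Finset.Icc (ℓ + 1) n →
      (∀ x ∈ K, 1 ≤ g x ∧ g x < x) →
      (K = insert (ℓ + 1) (Finset.image j Finset.univ) ∧ g (ℓ + 1) = m) →
      P (aIJ ℓ n K g) = aIJ ℓ n K g)
    (hP2 : ∀ (K : Finset ℕ) (g : ℕ → ℕ), K ⊆ Finset.Icc (ℓ + 1) n →
      (∀ x ∈ K, 1 ≤ g x ∧ g x < x) → (∀ x, x ∉ K → g x = 0) →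
      ¬(K = insert (ℓ + 1) (Finset.image j Finset.univ) ∧ g (ℓ + 1) = m) →
      P (aIJ ℓ n K g) = 0) :
    P (omegaK ℓ n lam (j (Fin.last q)) * aTup ℓ n j i)
      = ∑ᶠ K : Adm ℓ m j i (Fin.last q),
          lam (K.val (Fin.last q), j (Fin.last q)) •
            (a ℓ n m (ℓ + 1) * (List.ofFn (bfun ℓ n j i K)).prod) := by
  have hjinj := hjmono.injective
  have hjn : ∀ p, ℓ + 1 ≤ j p ∧ j p ≤ n := fun p => ⟨by have := (hj p).1; omega, (hj p).2⟩
  have hcol : ∀ p, a ℓ n (i p) (j p) ∈ col ℓ n (j p) := fun p => a_mem_col (hi p).1 (hi p).2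
  have hor := exists_adm_or_map_eq_zero (s := Fin.last q) hjmono hj hi hm2 P
    (fun c hc => map_a_mul_prod_eq_of_basis P LinearMap.id hjinj hjn hm1 (by omega) le_rfl
      (by omega) (fun p => by have := (hj p).1; omega)
      (fun g hK hg _ hgm => hP1 _ g hK hg ⟨rfl, hgm⟩) c hc)
    (fun u v hu huv hℓv hvn hvj hvu c hc => map_a_mul_prod_eq_of_basis P 0 hjinj hjn hu huv hℓv
      hvn hvj (fun g hK hg hg0 hgv => by
        refine hP2 _ g hK hg hg0 fun ⟨hKeq, hgm⟩ => ?_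
        have hmem : v ∈ insert (ℓ + 1) (Finset.image j Finset.univ) :=
          hKeq ▸ Finset.mem_insert_self _ _
        rw [Finset.mem_insert, Finset.mem_image] at hmem
        rcases hmem with rfl | ⟨p, -, hp⟩
        · exact hvu ⟨rfl, hgv.symm.trans hgm⟩
        · exact hvj p hp) c hc)
  have hinj : Function.Injective fun K : Adm ℓ m j i (Fin.last q) => K.k (Fin.last K.t) :=
    Adm.injective_k_last hjmono (fun p => (hj p).1) hm2
  set G : ℕ → A ℓ n := fun k => lam (k, j (Fin.last q)) • P (a ℓ n k (j (Fin.last q)) *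
    (List.ofFn fun p => a ℓ n (i p) (j p)).prod) with hG
  have hterm : ∀ K : Adm ℓ m j i (Fin.last q),
      lam (K.val (Fin.last q), j (Fin.last q)) •
        (a ℓ n m (ℓ + 1) * (List.ofFn (bfun ℓ n j i K)).prod) = G (K.k (Fin.last K.t)) := by
    intro K
    have hne := K.val_ne (Fin.last K.t)
    rw [K.last_eq] at hne
    rcases hor _ _ (K.val_pos _) K.k_last_lt hne hcol fun _ _ => rfl with
      ⟨K', hKK', h⟩ | ⟨hK, -⟩
    · obtain rfl := hinj hKK'
      rw [hG, K'.val_last]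
      exact congrArg _ h.symm
    · exact absurd rfl (hK K)
  have hzero : ∀ k ∈ Finset.Ico 1 (j (Fin.last q)),
      k ∉ Set.range (fun K : Adm ℓ m j i (Fin.last q) => K.k (Fin.last K.t)) → G k = 0 := by
    intro k hk hkK
    rw [Finset.mem_Ico] at hk
    by_cases hki : k = i (Fin.last q)
    · rw [hG, hki]
      simp only
      rw [mul_prod_ofFn_eq_zero _ (Fin.last q) (fun p => a_mul_a_swap _ _ _ _) (a_mul_self _ _),
        map_zero, smul_zero]
    · rcases hor _ _ hk.1 hk.2 hki hcol fun _ _ => rfl with ⟨K, hK, -⟩ | ⟨-, h⟩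
      · exact absurd ⟨K, hK⟩ hkK
      · simp only [hG]
        rw [h, smul_zero]
  rw [finsum_congr hterm, ← finsum_mem_range (f := G) hinj,
    finsum_mem_eq_sum_of_inter_support_eq (t := Finset.Ico 1 (j (Fin.last q))) G ?_]
  · rw [omegaK, Finset.sum_mul, map_sum]
    refine Finset.sum_congr rfl fun k _ => ?_
    rw [smul_mul_assoc, map_smul]
    rfl
  · ext k
    simp only [Set.mem_inter_iff, Function.mem_support, Finset.mem_coe]
    refine and_congr_left fun hGk => ⟨?_, fun hk => ?_⟩
    · rintro ⟨K, rfl⟩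
      exact Finset.mem_Ico.2 ⟨K.val_pos _, K.k_last_lt⟩
    · by_contra hkK
      exact hGk (hzero k hk hkK)

end OSDisc
end
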